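/- arXiv:2006.11104 — 10 statements merged into one kernel-verified Lean document; each statement's English description precedes it below -/
import Mathlib

section
/- Let G be a finite group and H a subgroup of G. Then H is a perfect code of G if and only if H is a perfect code of every subgroup K of G with H ≤ K. -/
/-- A subgroup `H` of a finite group `G` is a *perfect code* of `G` if there exists a subset
`T` of `G` that is inverse-closed and is a right transversal of `H` in `G` (i.e., every element
of `G` can be written uniquely as `h * t` with `h ∈ H` and `t ∈ T`). -/
def Subgroup.IsPerfectCode {G : Type*} [Group G] (H : Subgroup G) : Prop :=
  ∃ T : Set G, T⁻¹ = T ∧ Subgroup.IsComplement (H : Set G) T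

namespace Subgroup

variable {G : Type*} [Group G] {H : Subgroup G}

theorem isComplement_left_iff_existsUnique_mem {T : Set G} :
    IsComplement (H : Set G) T ↔ ∀ g, ∃! t, t ∈ T ∧ g * t⁻¹ ∈ H := by
  rw [isComplement_iff_existsUnique_mul_inv_mem]
  refine forall_congr' fun g => ⟨?_, ?_⟩
  · rintro ⟨⟨t, ht⟩, h, hu⟩
    exact ⟨t, ⟨ht, h⟩, fun s hs => congrArg Subtype.val (hu ⟨s, hs.1⟩ hs.2)⟩
  · rintro ⟨t, ⟨ht, h⟩, hu⟩
    exact ⟨⟨t, ht⟩, h, fun s hs => Subtype.ext (hu s ⟨s.2, hs⟩)⟩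

theorem IsPerfectCode.subgroupOf (hH : H.IsPerfectCode) {K : Subgroup G} (hK : H ≤ K) :
    (H.subgroupOf K).IsPerfectCode := by
  obtain ⟨T, hT, hc⟩ := hH
  rw [isComplement_left_iff_existsUnique_mem] at hc
  refine ⟨(↑) ⁻¹' T, ?_, isComplement_left_iff_existsUnique_mem.2 fun g => ?_⟩
  · ext k
    simp only [Set.mem_inv, Set.mem_preimage, coe_inv]
    rw [← Set.mem_inv, hT]
  · obtain ⟨t, ⟨ht, h⟩, hu⟩ := hc g
    have htK : t ∈ K := by
      simpa using K.mul_mem (K.inv_mem (hK h)) g.2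
    exact ⟨⟨t, htK⟩, ⟨ht, h⟩, fun s hs => Subtype.ext (hu s hs)⟩

theorem IsPerfectCode.of_subgroupOf_top (hH : (H.subgroupOf ⊤).IsPerfectCode) :
    H.IsPerfectCode := by
  obtain ⟨T, hT, hc⟩ := hH
  rw [isComplement_left_iff_existsUnique_mem] at hc
  refine ⟨{g | ⟨g, mem_top g⟩ ∈ T}, ?_, isComplement_left_iff_existsUnique_mem.2 fun g => ?_⟩
  · ext g
    exact Set.ext_iff.1 hT ⟨g, mem_top g⟩
  · obtain ⟨t, ⟨ht, h⟩, hu⟩ := hc ⟨g, mem_top g⟩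
    exact ⟨t, ⟨ht, h⟩, fun s hs => congrArg Subtype.val (hu ⟨s, mem_top s⟩ hs)⟩

end Subgroup

theorem perfectCode_iff_perfectCode_of_all_overgroups {G : Type*} [Group G] [Finite G]
    (H : Subgroup G) :
    H.IsPerfectCode ↔ ∀ K : Subgroup G, H ≤ K → (H.subgroupOf K).IsPerfectCode :=
  ⟨fun h _ hK => h.subgroupOf hK, fun h => .of_subgroupOf_top (h ⊤ le_top)⟩
end

section
/- Let G be a finite group and H a subgroup of G. If H is a perfect code of G, then for every g ∈ G the conjugate subgroup g⁻¹Hg is a perfect code of G. -/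
theorem Subgroup.IsComplement.image_mulEquiv {G K : Type*} [Group G] [Group K] {S T : Set G}
    (h : Subgroup.IsComplement S T) (φ : G ≃* K) :
    Subgroup.IsComplement (φ '' S) (φ '' T) := by
  constructor
  · rintro ⟨⟨_, s, hs, rfl⟩, ⟨_, t, ht, rfl⟩⟩ ⟨⟨_, s', hs', rfl⟩, ⟨_, t', ht', rfl⟩⟩ heq
    have hmul : s * t = s' * t' := φ.injective (by simpa using heq)
    have hpair := @h.1 (⟨s, hs⟩, ⟨t, ht⟩) (⟨s', hs'⟩, ⟨t', ht'⟩) hmul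
    simp only [Prod.mk.injEq, Subtype.mk.injEq] at hpair ⊢
    exact ⟨Subtype.ext (congrArg φ hpair.1), Subtype.ext (congrArg φ hpair.2)⟩
  · intro k
    obtain ⟨⟨s, t⟩, hst⟩ := h.2 (φ.symm k)
    refine ⟨(⟨φ s, s, s.2, rfl⟩, ⟨φ t, t, t.2, rfl⟩), ?_⟩
    simpa using congrArg φ hst

theorem Subgroup.IsPerfectCode.map_mulEquiv {G K : Type*} [Group G] [Group K] {H : Subgroup G}
    (hH : H.IsPerfectCode) (φ : G ≃* K) : (H.map φ.toMonoidHom).IsPerfectCode := by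
  obtain ⟨T, hT, hc⟩ := hH
  refine ⟨φ '' T, ?_, by simpa using hc.image_mulEquiv φ⟩
  rw [← Set.image_inv φ, hT]

theorem conj_isPerfectCode {G : Type*} [Group G] [Finite G] (H : Subgroup G)
    (hH : H.IsPerfectCode) (g : G) :
    (H.map (MulAut.conj g⁻¹).toMonoidHom).IsPerfectCode := hH.map_mulEquiv _
end

section
/- Let G be a finite group and H a subgroup of G. If either the order |H| is odd or the index |G : H| is odd, then H is a perfect code of G. -/
open scoped Pointwise

namespace Subgroup

variable {G : Type*} [Group G]

/-- A set meeting every right coset of `H` in at most one element. -/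
def IsPartialRightTransversal (H : Subgroup G) (S : Set G) : Prop :=
  ∀ s ∈ S, ∀ t ∈ S, s * t⁻¹ ∈ H → s = t

theorem IsPartialRightTransversal.mono {H : Subgroup G} {S T : Set G}
    (hT : H.IsPartialRightTransversal T) (h : S ⊆ T) : H.IsPartialRightTransversal S :=
  fun s hs t ht => hT s (h hs) t (h ht)

theorem IsPartialRightTransversal.insert {H : Subgroup G} {S : Set G} {g : G}
    (hS : H.IsPartialRightTransversal S) (hg : ∀ s ∈ S, g * s⁻¹ ∉ H) :
    H.IsPartialRightTransversal (insert g S) := by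
  rintro s (rfl | hs) t (rfl | ht) hst
  · rfl
  · exact absurd hst (hg t ht)
  · exact absurd (by simpa using H.inv_mem hst) (hg s hs)
  · exact hS s hs t ht hst

theorem IsPartialRightTransversal.ncard_mul {H : Subgroup G} {S : Set G}
    (hS : H.IsPartialRightTransversal S) :
    ((H : Set G) * S).ncard = Nat.card H * S.ncard := by
  have hinj : Set.InjOn (fun x : G × G => x.1 * x.2) ((H : Set G) ×ˢ S) := by
    rintro ⟨h, s⟩ ⟨hh, hs⟩ ⟨k, t⟩ ⟨hk, ht⟩ he
    dsimp only at he hh hk hs ht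
    have hst : s = t := by
      refine hS s hs t ht ?_
      have : s * t⁻¹ = h⁻¹ * k := by
        rw [mul_inv_eq_iff_eq_mul, mul_assoc, ← he, inv_mul_cancel_left]
      rw [this]
      exact H.mul_mem (H.inv_mem hh) hk
    subst hst
    simpa using he
  rw [← Set.image_mul_prod, hinj.ncard_image, Set.ncard_prod]
  rfl

/-- The double coset of `y` consists of `|H : H ∩ yHy⁻¹|` left cosets of `H`. -/
theorem ncard_doubleCoset (H : Subgroup G) (y : G) :
    (DoubleCoset.doubleCoset y (H : Set G) H).ncard =
      Nat.card H * (H.comap (MulAut.conj y⁻¹).toMonoidHom).relIndex H := by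
  have hD : DoubleCoset.doubleCoset y (H : Set G) H =
      QuotientGroup.mk ⁻¹' (MulAction.orbit H (y : G ⧸ H)) := by
    ext g
    simp only [DoubleCoset.mem_doubleCoset, Set.mem_preimage, MulAction.mem_orbit_iff]
    constructor
    · rintro ⟨h, hh, k, hk, rfl⟩
      refine ⟨⟨h, hh⟩, ?_⟩
      change ((h * y : G) : G ⧸ H) = _
      rw [QuotientGroup.eq]
      simpa [mul_assoc] using hk
    · rintro ⟨h, hh⟩
      change ((h * y : G) : G ⧸ H) = _ at hh
      rw [QuotientGroup.eq] at hh
      exact ⟨h, h.2, _, hh, by group⟩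
  have hK : (H.comap (MulAut.conj y⁻¹).toMonoidHom).subgroupOf H =
      MulAction.stabilizer H (y : G ⧸ H) := by
    ext h
    rw [MulAction.mem_stabilizer_iff]
    change _ ↔ ((h * y : G) : G ⧸ H) = _
    rw [eq_comm, QuotientGroup.eq]
    simp [mem_subgroupOf, mul_assoc]
  rw [relIndex, hK, MulAction.index_stabilizer, hD, ← Nat.card_coe_set_eq,
    QuotientGroup.card_preimage_mk, Nat.card_coe_set_eq]

theorem mem_of_sq_mem_of_odd_index {K : Subgroup G} [K.Normal] (hK : Odd K.index) {y : G}
    (hy : y * y ∈ K) : y ∈ K := by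
  obtain ⟨m, hm⟩ := hK
  have h := K.pow_index_mem y
  rw [hm, pow_succ, pow_mul, pow_two] at h
  exact (K.mul_mem_cancel_left (K.pow_mem hy m)).1 h

theorem mem_of_sq_mem_of_odd_relIndex {H : Subgroup G} (hH : Odd H.index) {y : G}
    (hy : y * y ∈ H) (hr : Odd ((H.comap (MulAut.conj y⁻¹).toMonoidHom).relIndex H)) :
    y ∈ H := by
  set C := H.comap (MulAut.conj y⁻¹).toMonoidHom
  have hC : ∀ h, h ∈ C ↔ y⁻¹ * h * y ∈ H := fun h => by simp [C]
  have hyn : y ∈ normalizer (C ⊓ H : Subgroup G) := by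
    rw [mem_normalizer_iff]
    intro h
    simp only [mem_inf, hC]
    constructor
    · rintro ⟨h1, h2⟩
      refine ⟨by simpa [mul_assoc] using h2, ?_⟩
      simpa [mul_assoc] using H.mul_mem (H.mul_mem hy h1) (H.inv_mem hy)
    · rintro ⟨h1, h2⟩
      have h3 : h ∈ H := by simpa [mul_assoc] using h1
      refine ⟨?_, h3⟩
      simpa [mul_assoc] using H.mul_mem (H.mul_mem (H.inv_mem hy) h2) hy
  have hodd : Odd (C ⊓ H).index := by
    rw [← relIndex_mul_index (inf_le_right : C ⊓ H ≤ H), inf_relIndex_right]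
    exact hr.mul hH
  have hodd' : Odd ((C ⊓ H).subgroupOf (normalizer (C ⊓ H : Subgroup G))).index :=
    Odd.of_dvd_nat hodd (relIndex_dvd_index_of_le le_normalizer)
  have h2 : y * y ∈ C ⊓ H := ⟨(hC _).2 (by simpa [mul_assoc] using hy), hy⟩
  have := mem_of_sq_mem_of_odd_index hodd' (y := ⟨y, hyn⟩) (by simpa [mem_subgroupOf] using h2)
  exact (mem_subgroupOf.1 this).2

theorem even_ncard_of_inv_eq [Finite G] {S : Set G} (hS : S⁻¹ = S)
    (h : ∀ s ∈ S, s⁻¹ ≠ s) : Even S.ncard := by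
  classical
  have hfin := S.toFinite
  rw [Set.ncard_eq_toFinset_card S hfin, ← ZMod.natCast_eq_zero_iff_even,
    Finset.card_eq_sum_ones, Nat.cast_sum]
  refine Finset.sum_involution (fun a _ => a⁻¹) (fun _ _ => by decide)
    (fun a ha _ => h a (by simpa using ha)) (fun a ha => ?_) (fun a _ => inv_inv a)
  rw [Set.Finite.mem_toFinset] at ha ⊢
  rwa [← hS, Set.inv_mem_inv]

theorem inv_doubleCoset (H : Subgroup G) (x : G) :
    (DoubleCoset.doubleCoset x (H : Set G) H)⁻¹ =
      DoubleCoset.doubleCoset x⁻¹ (H : Set G) H := by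
  rw [DoubleCoset.doubleCoset, DoubleCoset.doubleCoset, mul_inv_rev, mul_inv_rev,
    Set.inv_singleton, inv_coe_set, ← mul_assoc]

/-- A self-inverse double coset without elements of order at most two consists of an even number
of cosets, as soon as `H` has odd order or odd index. -/
theorem two_mul_card_dvd_ncard_doubleCoset [Finite G] {H : Subgroup G}
    (hH : Odd (Nat.card H) ∨ Odd H.index) {x : G}
    (hx : x⁻¹ ∈ DoubleCoset.doubleCoset x (H : Set G) H)
    (hinv : ∀ u ∈ DoubleCoset.doubleCoset x (H : Set G) H, u⁻¹ ≠ u) :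
    2 * Nat.card H ∣ (DoubleCoset.doubleCoset x (H : Set G) H).ncard := by
  obtain ⟨h, hh, k, hk, hxe⟩ := DoubleCoset.mem_doubleCoset.1 hx
  rcases hH with hH | hH
  · refine Nat.Coprime.mul_dvd_of_dvd_of_dvd (Nat.coprime_two_left.2 hH) ?_ ?_
    · refine (even_ncard_of_inv_eq ?_ hinv).two_dvd
      rw [inv_doubleCoset, DoubleCoset.doubleCoset_eq_of_mem hx]
    · rw [ncard_doubleCoset]
      exact dvd_mul_right _ _
  · have hy : x * h ∈ DoubleCoset.doubleCoset x (H : Set G) H :=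
      DoubleCoset.mem_doubleCoset.2 ⟨1, H.one_mem, h, hh, by simp⟩
    have hsq : (x * h) * (x * h) ∈ H := by
      have : (x * h) * (x * h) = k⁻¹ * h := by
        have : h * x = x⁻¹ * k⁻¹ := by rw [hxe]; group
        rw [mul_assoc, ← mul_assoc h, this]; group
      rw [this]
      exact H.mul_mem (H.inv_mem hk) hh
    rw [← DoubleCoset.doubleCoset_eq_of_mem hy] at hinv ⊢
    rw [ncard_doubleCoset, mul_comm 2]
    refine mul_dvd_mul_left _ (even_iff_two_dvd.1 ?_)
    by_contra hodd
    have hyH := mem_of_sq_mem_of_odd_relIndex hH hsq (Nat.not_even_iff_odd.1 hodd)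
    refine hinv 1 (DoubleCoset.mem_doubleCoset.2
      ⟨1, H.one_mem, (x * h)⁻¹, H.inv_mem hyH, by simp⟩) inv_one

/-- In a maximal inverse-closed partial transversal there is no room for a further pair
`t, t⁻¹`. -/
theorem false_of_maximal {H : Subgroup G} {S : Set G}
    (hS : Maximal (fun S : Set G => S⁻¹ = S ∧ H.IsPartialRightTransversal S) S) {t : G}
    (ht : ∀ s ∈ S, t * s⁻¹ ∉ H) (ht' : ∀ s ∈ S, t⁻¹ * s⁻¹ ∉ H)
    (htt : t = t⁻¹ ∨ t * t ∉ H) : False := by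
  have hsub : S ⊆ insert t (insert t⁻¹ S) :=
    (Set.subset_insert _ _).trans (Set.subset_insert _ _)
  have hmem : t ∈ S := by
    refine hS.2 ⟨?_, ?_⟩ hsub (Set.mem_insert _ _)
    · rw [Set.inv_insert, Set.inv_insert, hS.1.1, inv_inv, Set.insert_comm]
    · rcases htt with h | h
      · rw [← h, Set.insert_idem]
        exact hS.1.2.insert ht
      · refine (hS.1.2.insert ht').insert ?_
        rintro s (rfl | hs)
        · simpa using h
        · exact ht s hs
  exact ht t hmem (by simp)

theorem false_of_maximal_of_mem {H : Subgroup G} {S : Set G}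
    (hS : Maximal (fun S : Set G => S⁻¹ = S ∧ H.IsPartialRightTransversal S) S) {g g' : G}
    (hg : ∀ s ∈ S, g * s⁻¹ ∉ H) (hg' : ∀ s ∈ S, g' * s⁻¹ ∉ H)
    (h : g' ∈ DoubleCoset.doubleCoset g⁻¹ (H : Set G) H) (hne : g' * g⁻¹ ∉ H) : False := by
  obtain ⟨a, ha, b, hb, rfl⟩ := DoubleCoset.mem_doubleCoset.1 h
  refine false_of_maximal hS (t := b⁻¹ * g) (fun s hs => ?_) (fun s hs => ?_) (Or.inr ?_)
  · rw [mul_assoc, H.mul_mem_cancel_left (H.inv_mem hb)]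
    exact hg s hs
  · rw [← H.mul_mem_cancel_left ha]
    simpa [mul_assoc] using hg' s hs
  · intro h
    refine hne ?_
    have : a * g⁻¹ * b * g⁻¹ = a * (b⁻¹ * g * (b⁻¹ * g))⁻¹ * b⁻¹ := by group
    rw [this]
    exact H.mul_mem (H.mul_mem ha (H.inv_mem h)) (H.inv_mem hb)

theorem mul_inter_doubleCoset_subset (H : Subgroup G) (S : Set G) (x : G) :
    (H : Set G) * (S ∩ DoubleCoset.doubleCoset x (H : Set G) H) ⊆
      DoubleCoset.doubleCoset x (H : Set G) H := by
  rintro _ ⟨h, hh, s, ⟨-, hs⟩, rfl⟩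
  obtain ⟨a, ha, b, hb, rfl⟩ := DoubleCoset.mem_doubleCoset.1 hs
  exact DoubleCoset.mem_doubleCoset.2 ⟨h * a, H.mul_mem hh ha, b, hb, by group⟩

theorem doubleCoset_eq_mul_inter {H : Subgroup G} {S : Set G} {x : G}
    (h : ∀ g ∈ DoubleCoset.doubleCoset x (H : Set G) H, ∃ s ∈ S, g * s⁻¹ ∈ H) :
    DoubleCoset.doubleCoset x (H : Set G) H =
      (H : Set G) * (S ∩ DoubleCoset.doubleCoset x (H : Set G) H) := by
  refine Set.Subset.antisymm (fun g hg => ?_) (mul_inter_doubleCoset_subset H S x)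
  obtain ⟨s, hs, hgs⟩ := h g hg
  refine ⟨g * s⁻¹, hgs, s, ⟨hs, ?_⟩, by simp⟩
  obtain ⟨a, ha, b, hb, rfl⟩ := DoubleCoset.mem_doubleCoset.1 hg
  exact DoubleCoset.mem_doubleCoset.2
    ⟨(a * x * b * s⁻¹)⁻¹ * a, H.mul_mem (H.inv_mem hgs) ha, b, hb, by group⟩

/-- A maximal inverse-closed partial transversal meets every right coset. -/
theorem exists_mul_inv_mem_of_maximal [Finite G] {H : Subgroup G}
    (hH : Odd (Nat.card H) ∨ Odd H.index) {S : Set G}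
    (hS : Maximal (fun S : Set G => S⁻¹ = S ∧ H.IsPartialRightTransversal S) S) (g : G) :
    ∃ s ∈ S, g * s⁻¹ ∈ H := by
  by_contra! hg
  have hgD := DoubleCoset.mem_doubleCoset_self H H g
  have hpos : 0 < Nat.card H := Nat.card_pos
  by_cases hx : g⁻¹ ∈ DoubleCoset.doubleCoset g (H : Set G) H
  · have hDi := DoubleCoset.doubleCoset_eq_of_mem hx
    have hinv : ∀ u ∈ DoubleCoset.doubleCoset g (H : Set G) H, u⁻¹ ≠ u := by
      intro u hu huu
      obtain ⟨a, ha, b, hb, rfl⟩ := DoubleCoset.mem_doubleCoset.1 hu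
      have hc : (b * a * g)⁻¹ = b * a * g := by
        have : (b * a * g)⁻¹ = b * (a * g * b)⁻¹ * b⁻¹ := by group
        rw [this, huu]; group
      have hcov : ∀ s ∈ S, b * a * g * s⁻¹ ∉ H := fun s hs => by
        rw [mul_assoc, H.mul_mem_cancel_left (H.mul_mem hb ha)]
        exact hg s hs
      exact false_of_maximal hS hcov (by rwa [hc]) (Or.inl hc.symm)
    have hcov : ∀ g' ∈ DoubleCoset.doubleCoset g (H : Set G) H,
        ∃ s ∈ insert g S, g' * s⁻¹ ∈ H := by
      intro g' hg'
      by_contra! hn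
      exact false_of_maximal_of_mem hS hg (fun s hs => hn s (Set.mem_insert_of_mem _ hs))
        (by rwa [hDi]) (hn g (Set.mem_insert _ _))
    have hdvd := two_mul_card_dvd_ncard_doubleCoset hH hx hinv
    rw [doubleCoset_eq_mul_inter hcov,
      ((hS.1.2.insert hg).mono Set.inter_subset_left).ncard_mul, mul_comm 2,
      Nat.mul_dvd_mul_iff_left hpos, Set.insert_inter_of_mem hgD,
      Set.ncard_insert_of_notMem (fun h => hg g h.1 (by simp)), ← even_iff_two_dvd,
      Nat.even_add_one] at hdvd
    refine hdvd (even_ncard_of_inv_eq ?_ fun s hs => hinv s hs.2)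
    rw [Set.inter_inv, hS.1.1, inv_doubleCoset, hDi]
  · have hcov : ∀ g' ∈ DoubleCoset.doubleCoset g⁻¹ (H : Set G) H, ∃ s ∈ S, g' * s⁻¹ ∈ H := by
      intro g' hg'
      by_contra! hn
      refine false_of_maximal_of_mem hS hg hn hg' fun hmem => hx ?_
      obtain ⟨a, ha, b, hb, rfl⟩ := DoubleCoset.mem_doubleCoset.1 hg'
      refine DoubleCoset.mem_doubleCoset.2 ⟨a⁻¹ * (a * g⁻¹ * b * g⁻¹),
        H.mul_mem (H.inv_mem ha) hmem, b⁻¹, H.inv_mem hb, by group⟩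
    have hcard := congrArg Set.ncard (doubleCoset_eq_mul_inter hcov)
    rw [(hS.1.2.mono Set.inter_subset_left).ncard_mul, ← inv_doubleCoset, Set.ncard_inv] at hcard
    nth_rw 1 [← hS.1.1] at hcard
    rw [← Set.inter_inv, Set.ncard_inv,
      ← (hS.1.2.mono Set.inter_subset_left).ncard_mul] at hcard
    have heq := Set.eq_of_subset_of_ncard_le (mul_inter_doubleCoset_subset H S g) hcard.le
    rw [← heq] at hgD
    obtain ⟨h, hh, s, hs, rfl⟩ := hgD
    exact hg s hs.1 (by simpa using hh)

end Subgroup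

theorem isPerfectCode_of_odd_card_or_odd_index {G : Type*} [Group G] [Finite G]
    (H : Subgroup G) (hH : Odd (Nat.card H) ∨ Odd H.index) :
    H.IsPerfectCode := by
  obtain ⟨S, -, hS⟩ := (Set.toFinite
    {S : Set G | S⁻¹ = S ∧ H.IsPartialRightTransversal S}).exists_le_maximal (a := ∅)
      ⟨Set.inv_empty, fun s hs => hs.elim⟩
  refine ⟨S, hS.1.1, Subgroup.isComplement_iff_existsUnique_mul_inv_mem.2 fun g => ?_⟩
  obtain ⟨s, hs, hgs⟩ := Subgroup.exists_mul_inv_mem_of_maximal hH hS g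
  refine ⟨⟨s, hs⟩, hgs, fun ⟨t, ht⟩ hgt => Subtype.ext (hS.1.2 t ht s hs ?_)⟩
  have : t * s⁻¹ = (g * t⁻¹)⁻¹ * (g * s⁻¹) := by group
  rw [this]
  exact H.mul_mem (H.inv_mem hgt) hgs
end

section
/- Let G be a finite group, N a normal subgroup of G, and H a subgroup of G containing N. If H is a perfect code of G, then the quotient subgroup H/N is a perfect code of the quotient group G/N. -/
theorem quotient_isPerfectCode_of_isPerfectCode {G : Type*} [Group G] [Finite G]
    (N H : Subgroup G) [N.Normal] (hNH : N ≤ H) (h : H.IsPerfectCode) :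
    (H.map (QuotientGroup.mk' N)).IsPerfectCode := by
  obtain ⟨T, hT, hHT⟩ := h
  rw [Subgroup.isComplement_iff_existsUnique_mul_inv_mem] at hHT
  have mem_map (g : G) : QuotientGroup.mk' N g ∈ H.map (QuotientGroup.mk' N) ↔ g ∈ H := by
    rw [← Subgroup.mem_comap, Subgroup.comap_map_eq_self (by simpa using hNH)]
  refine ⟨QuotientGroup.mk' N '' T, ?_, ?_⟩
  · rw [← Set.image_inv, hT]
  rw [Subgroup.isComplement_iff_existsUnique_mul_inv_mem]
  intro x
  obtain ⟨g, rfl⟩ := QuotientGroup.mk'_surjective N x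
  obtain ⟨t, ht, huniq⟩ := hHT g
  refine ⟨⟨QuotientGroup.mk' N t, t, t.2, rfl⟩, ?_, ?_⟩
  · simpa only [← map_inv, ← map_mul, SetLike.mem_coe, mem_map] using ht
  · rintro ⟨_, s, hs, rfl⟩ hgs
    rw [← map_inv, ← map_mul, SetLike.mem_coe, mem_map] at hgs
    exact Subtype.ext (congrArg (QuotientGroup.mk' N) (congrArg Subtype.val (huniq ⟨s, hs⟩ hgs)))
end

section
/- Let G be a finite group, N a normal subgroup of G, and H a subgroup of G containing N. If N is a perfect code of G and the quotient subgroup H/N is a perfect code of the quotient group G/N, then H is a perfect code of G. -/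
theorem Subgroup.isComplement_inter_preimage_mk {G : Type*} [Group G] {N H : Subgroup G}
    [N.Normal] (hNH : N ≤ H) {A : Set G} {B : Set (G ⧸ N)}
    (hA : Subgroup.IsComplement (N : Set G) A)
    (hB : Subgroup.IsComplement (H.map (QuotientGroup.mk' N) : Set (G ⧸ N)) B) :
    Subgroup.IsComplement (H : Set G) (A ∩ QuotientGroup.mk' N ⁻¹' B) := by
  rw [Subgroup.isComplement_iff_existsUnique_mul_inv_mem] at hA hB ⊢
  have mem_map (x : G) :
      QuotientGroup.mk' N x ∈ (H.map (QuotientGroup.mk' N) : Set (G ⧸ N)) ↔ x ∈ H := by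
    rw [SetLike.mem_coe, ← Subgroup.mem_comap, Subgroup.comap_map_eq_self]
    simpa using hNH
  have mem_of_mk_eq {x y : G} (h : QuotientGroup.mk' N x = QuotientGroup.mk' N y) :
      x * y⁻¹ ∈ N := by
    rw [← QuotientGroup.ker_mk' N, MonoidHom.mem_ker, map_mul, map_inv, h, mul_inv_cancel]
  have mk_eq_of_mem {x y : G} (h : x * y⁻¹ ∈ N) :
      QuotientGroup.mk' N x = QuotientGroup.mk' N y := by
    rwa [← QuotientGroup.ker_mk' N, MonoidHom.mem_ker, map_mul, map_inv, mul_inv_eq_one] at h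
  intro g
  obtain ⟨⟨b, hb⟩, hgb, huniq⟩ := hB (QuotientGroup.mk' N g)
  obtain ⟨c, rfl⟩ := QuotientGroup.mk'_surjective N b
  obtain ⟨⟨a, ha⟩, hca, huniq'⟩ := hA c
  have hac : QuotientGroup.mk' N c = QuotientGroup.mk' N a := mk_eq_of_mem hca
  refine ⟨⟨a, ha, ?_⟩, ?_, ?_⟩
  · rwa [Set.mem_preimage, ← hac]
  · refine (mem_map _).1 ?_
    rw [map_mul, map_inv, ← hac]
    exact hgb
  · rintro ⟨t, htA, htB⟩ ht
    have htc : QuotientGroup.mk' N t = QuotientGroup.mk' N c :=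
      congrArg Subtype.val (huniq ⟨_, htB⟩ (by
        have := (mem_map _).2 ht
        rwa [map_mul, map_inv] at this))
    have hta : t = a := congrArg Subtype.val (huniq' ⟨t, htA⟩ (mem_of_mk_eq htc.symm))
    exact Subtype.ext hta

theorem isPerfectCode_of_quotient_isPerfectCode {G : Type*} [Group G] [Finite G]
    (N H : Subgroup G) [N.Normal] (hNH : N ≤ H) (hN : N.IsPerfectCode)
    (hHN : (H.map (QuotientGroup.mk' N)).IsPerfectCode) :
    H.IsPerfectCode := by
  obtain ⟨A, hAinv, hA⟩ := hN
  obtain ⟨B, hBinv, hB⟩ := hHN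
  refine ⟨A ∩ QuotientGroup.mk' N ⁻¹' B, ?_, Subgroup.isComplement_inter_preimage_mk hNH hA hB⟩
  ext x
  rw [Set.mem_inv, Set.mem_inter_iff, Set.mem_inter_iff, Set.mem_preimage, Set.mem_preimage,
    map_inv, ← Set.mem_inv, ← Set.mem_inv, hAinv, hBinv]
end

section
/- Let G be a finite group, H a normal subgroup of G, and K a subgroup of H containing the commutator subgroup [G,H]. If H is a perfect code of G, [G,H] is a perfect code of G, and K is a perfect code of H, then K is a perfect code of G. -/
namespace Subgroup

variable {G : Type*} [Group G] {N : Subgroup G}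

theorem IsPerfectCode.exists_mul_sq_eq_one [N.Normal] (hN : N.IsPerfectCode) {x : G}
    (hx : x ^ 2 ∈ N) : ∃ n ∈ N, (n * x) ^ 2 = 1 := by
  obtain ⟨T, hT, hc⟩ := hN
  obtain ⟨⟨⟨n, hn⟩, ⟨t, ht⟩⟩, rfl⟩ := hc.surjective x
  have htN : t ^ 2 ∈ N := by
    rw [SetLike.mem_coe] at hn
    rw [← QuotientGroup.eq_one_iff] at hn hx ⊢
    simpa [hn] using hx
  have ht' : t⁻¹ ∈ T := by rw [← hT]; simpa using ht
  have key := @Function.Bijective.injective _ _ _ hc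
    (⟨t ^ 2, htN⟩, ⟨t⁻¹, ht'⟩) (⟨1, N.one_mem⟩, ⟨t, ht⟩) (by simp [sq])
  have h1 : t ^ 2 = 1 := by simpa using congrArg (fun p => (p.1 : G)) key
  exact ⟨n⁻¹, inv_mem hn, by simpa using h1⟩

theorem isPerfectCode_of_inv_section [N.Normal] (s : G ⧸ N → G)
    (hs : ∀ q, (s q : G ⧸ N) = q) (hinv : ∀ q, s q⁻¹ = (s q)⁻¹) : N.IsPerfectCode := by
  refine ⟨Set.range s, ?_, ?_, ?_⟩
  · ext x
    constructor
    · rintro ⟨q, hq⟩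
      exact ⟨q⁻¹, by rw [hinv, hq, inv_inv]⟩
    · rintro ⟨q, rfl⟩
      exact ⟨q⁻¹, hinv q⟩
  · rintro ⟨⟨a, ha⟩, ⟨_, q, rfl⟩⟩ ⟨⟨b, hb⟩, ⟨_, r, rfl⟩⟩ h
    have h : a * s q = b * s r := h
    have hqr : q = r := by
      have h' := congrArg (QuotientGroup.mk (s := N)) h
      rw [SetLike.mem_coe, ← QuotientGroup.eq_one_iff] at ha hb
      simpa [ha, hb, hs] using h'
    subst hqr
    obtain rfl := mul_right_cancel h
    rfl
  · intro x
    refine ⟨⟨⟨x * (s x)⁻¹, ?_⟩, ⟨s x, x, rfl⟩⟩, by simp⟩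
    rw [SetLike.mem_coe, ← QuotientGroup.eq_one_iff]
    simp [hs]

theorem isPerfectCode_of_forall_exists_mul_sq_eq_one [N.Normal]
    (h : ∀ x : G, x ^ 2 ∈ N → ∃ n ∈ N, (n * x) ^ 2 = 1) : N.IsPerfectCode := by
  have hinvol : ∀ q : G ⧸ N, ∃ g : G, (g : G ⧸ N) = q ∧ (q⁻¹ = q → g⁻¹ = g) := by
    intro q
    obtain ⟨x, rfl⟩ := QuotientGroup.mk_surjective q
    by_cases hq : (x : G ⧸ N)⁻¹ = x
    · have hx : x ^ 2 ∈ N := by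
        rw [← QuotientGroup.eq_one_iff, QuotientGroup.mk_pow, sq]
        exact inv_eq_iff_mul_eq_one.mp hq
      obtain ⟨n, hn, hnx⟩ := h x hx
      refine ⟨n * x, ?_, fun _ => ?_⟩
      · rw [← QuotientGroup.eq_one_iff] at hn
        simp [hn]
      · rw [inv_eq_iff_mul_eq_one, ← sq, hnx]
    · exact ⟨x, rfl, fun h => absurd h hq⟩
  choose g hg hginv using hinvol
  obtain ⟨_, -⟩ := exists_wellFoundedLT (G ⧸ N)
  refine isPerfectCode_of_inv_section (fun q => if q ≤ q⁻¹ then g q else (g q⁻¹)⁻¹) ?_ ?_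
  · intro q
    split_ifs <;> simp [hg]
  · intro q
    rcases lt_trichotomy q q⁻¹ with hq | hq | hq
    · simp [hq.le, hq.not_ge]
    · simp [← hq, hginv q hq.symm]
    · simp [hq.le, hq.not_ge]

theorem isPerfectCode_iff_forall_exists_mul_sq_eq_one [N.Normal] :
    N.IsPerfectCode ↔ ∀ x : G, x ^ 2 ∈ N → ∃ n ∈ N, (n * x) ^ 2 = 1 :=
  ⟨fun hN _ hx => hN.exists_mul_sq_eq_one hx, isPerfectCode_of_forall_exists_mul_sq_eq_one⟩

end Subgroup

theorem isPerfectCode_of_commutator_isPerfectCode {G : Type*} [Group G] [Finite G]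
    (H K : Subgroup G) [H.Normal] (hKH : K ≤ H)
    (hGHK : ⁅(⊤ : Subgroup G), H⁆ ≤ K)
    (h1 : H.IsPerfectCode)
    (h2 : (⁅(⊤ : Subgroup G), H⁆).IsPerfectCode)
    (h3 : (K.subgroupOf H).IsPerfectCode) :
    K.IsPerfectCode := by
  have hcomm : ∀ (g : G) {h : G}, h ∈ H → g * h * g⁻¹ * h⁻¹ ∈ ⁅(⊤ : Subgroup G), H⁆ :=
    fun g h hh => Subgroup.commutator_mem_commutator (Subgroup.mem_top g) hh
  have hK : K.Normal := ⟨fun k hk g => by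
    simpa using mul_mem (hGHK (hcomm g (hKH hk))) hk⟩
  rw [Subgroup.isPerfectCode_iff_forall_exists_mul_sq_eq_one] at h1 h2 h3 ⊢
  intro x hx
  obtain ⟨h, hh, hy⟩ := h1 x (hKH hx)
  have hhK : h ^ 2 ∈ K := by
    have hxh := hGHK (hcomm x hh)
    rw [← QuotientGroup.eq_one_iff] at hx hxh ⊢
    have hy' := congrArg (QuotientGroup.mk (s := K)) hy
    simp only [QuotientGroup.mk_mul, QuotientGroup.mk_pow, QuotientGroup.mk_inv,
      QuotientGroup.mk_one] at hx hxh hy' ⊢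
    have hc : Commute (x : G ⧸ K) h := by
      rw [mul_inv_eq_one, mul_inv_eq_iff_eq_mul] at hxh
      exact hxh
    rwa [hc.symm.mul_pow, hx, mul_one] at hy'
  obtain ⟨⟨k, hkH⟩, hk, he⟩ := h3 ⟨h, hh⟩ hhK
  have he : (k * h) ^ 2 = 1 := congrArg Subtype.val he
  have hk : k ∈ K := hk
  set y := h * x with hy_def
  set e := k * h with he_def
  have hyinv : y⁻¹ = y := by rw [inv_eq_iff_mul_eq_one, ← sq, hy]
  have heinv : e⁻¹ = e := by rw [inv_eq_iff_mul_eq_one, ← sq, he]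
  have hey : (y * e) ^ 2 ∈ ⁅(⊤ : Subgroup G), H⁆ := by
    have := hcomm y (mul_mem hkH hh : e ∈ H)
    rwa [hyinv, heinv, mul_assoc (y * e), ← sq] at this
  have hey : (e * y) ^ 2 ∈ ⁅(⊤ : Subgroup G), H⁆ := by
    have := inv_mem hey
    rwa [← inv_pow, mul_inv_rev, hyinv, heinv] at this
  obtain ⟨l, hl, hly⟩ := h2 (e * y) hey
  refine ⟨l * (k * h ^ 2), mul_mem (hGHK hl) (mul_mem hk hhK), ?_⟩
  rw [← hly, he_def, hy_def]
  simp only [sq, mul_assoc]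
end

section
/- Let G be a finite abelian group and H a subgroup of G. If H is a perfect code of G and K is a subgroup of H which is a perfect code of H, then K is a perfect code of G. -/
/-- A normal subgroup `H` is a perfect code if and only if every coset of `H` whose square is
trivial in the quotient contains an element whose square is trivial. -/
theorem Subgroup.Normal.isPerfectCode_iff {G : Type*} [Group G] {H : Subgroup G}
    (hN : H.Normal) :
    H.IsPerfectCode ↔ ∀ g : G, g ^ 2 ∈ H → ∃ t : G, t ^ 2 = 1 ∧ g * t⁻¹ ∈ H := by
  have mk_eq (a b : G) : a * b⁻¹ ∈ H ↔ (a : G ⧸ H) = b := by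
    rw [← QuotientGroup.eq_one_iff, QuotientGroup.mk_mul, QuotientGroup.mk_inv,
      mul_inv_eq_one]
  constructor
  · rintro ⟨T, hT, hc⟩ g hg
    rw [Subgroup.isComplement_iff_existsUnique_mul_inv_mem] at hc
    obtain ⟨t, ht, -⟩ := hc g
    have ht' : (t : G)⁻¹ ∈ T := by
      rw [← Set.mem_inv, hT]
      exact t.2
    have hsq : (t : G) * ((t : G)⁻¹)⁻¹ ∈ H := by
      rw [inv_inv, ← pow_two, ← QuotientGroup.eq_one_iff, QuotientGroup.mk_pow,
        ← (mk_eq g t).1 ht, ← QuotientGroup.mk_pow, QuotientGroup.eq_one_iff]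
      exact hg
    have h := (hc t).unique (y₁ := t) (y₂ := ⟨(t : G)⁻¹, ht'⟩) (by simp) hsq
    refine ⟨t, ?_, ht⟩
    rw [pow_two, mul_eq_one_iff_eq_inv]
    exact congrArg Subtype.val h
  · intro hsq
    have hinvol (q : G ⧸ H) (hq : q = q⁻¹) : ∃ t : G, t = t⁻¹ ∧ (t : G ⧸ H) = q := by
      obtain ⟨g, rfl⟩ := QuotientGroup.mk_surjective q
      obtain ⟨t, ht, hgt⟩ := hsq g <| by
        rw [← QuotientGroup.eq_one_iff, QuotientGroup.mk_pow, pow_two]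
        exact mul_eq_one_iff_eq_inv.2 hq
      exact ⟨t, mul_eq_one_iff_eq_inv.1 (pow_two t ▸ ht), ((mk_eq g t).1 hgt).symm⟩
    choose u hu_inv hu_mk using hinvol
    classical
    let : LinearOrder (G ⧸ H) := linearOrderOfSTO WellOrderingRel
    let s (q : G ⧸ H) : G :=
      if hq : q = q⁻¹ then u q hq else if q < q⁻¹ then q.out else (q⁻¹).out⁻¹
    have s_mk (q : G ⧸ H) : (s q : G ⧸ H) = q := by
      unfold s
      split_ifs with hq hlt
      · exact hu_mk q hq
      · exact QuotientGroup.out_eq' q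
      · rw [QuotientGroup.mk_inv, QuotientGroup.out_eq', inv_inv]
    have s_inv (q : G ⧸ H) : s q⁻¹ = (s q)⁻¹ := by
      by_cases hq : q = q⁻¹
      · rw [← hq]
        simp only [s, dif_pos hq]
        exact hu_inv q hq
      · have hq' : q⁻¹ ≠ q⁻¹⁻¹ := by rwa [inv_inv, ne_comm]
        simp only [s, dif_neg hq, dif_neg hq', inv_inv]
        rcases lt_or_gt_of_ne hq with h | h
        · rw [if_pos h, if_neg h.not_gt]
        · rw [if_pos h, if_neg h.not_gt, inv_inv]
    refine ⟨Set.range s, ?_, ?_⟩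
    · ext g
      rw [Set.mem_inv]
      constructor
      · rintro ⟨q, hq⟩
        exact ⟨q⁻¹, by rw [s_inv, hq, inv_inv]⟩
      · rintro ⟨q, rfl⟩
        exact ⟨q⁻¹, s_inv q⟩
    · rw [Subgroup.isComplement_iff_existsUnique_mul_inv_mem]
      intro g
      refine ⟨⟨s g, g, rfl⟩, (mk_eq _ _).2 (s_mk g).symm, ?_⟩
      rintro ⟨_, q, rfl⟩ hq
      refine Subtype.ext (congrArg s ?_)
      exact (s_mk q).symm.trans ((mk_eq g (s q)).1 hq).symm

theorem isPerfectCode_trans_of_comm {G : Type*} [CommGroup G] [Finite G]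
    (H K : Subgroup G) (hKH : K ≤ H)
    (hH : H.IsPerfectCode) (hK : (K.subgroupOf H).IsPerfectCode) :
    K.IsPerfectCode := by
  rw [(inferInstance : H.Normal).isPerfectCode_iff] at hH
  rw [(inferInstance : (K.subgroupOf H).Normal).isPerfectCode_iff] at hK
  rw [(inferInstance : K.Normal).isPerfectCode_iff]
  intro g hg
  obtain ⟨t, ht, hgt⟩ := hH g (hKH hg)
  obtain ⟨x, hx, hgx⟩ := hK ⟨g * t⁻¹, hgt⟩ <| by
    simpa [Subgroup.mem_subgroupOf, mul_pow, ht] using hg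
  refine ⟨x * t, ?_, ?_⟩
  · rw [mul_pow, ht, mul_one]
    exact congrArg Subtype.val hx
  · simpa [Subgroup.mem_subgroupOf, mul_assoc, mul_comm] using hgx
end

section
/- Let G be a finite group, P a Sylow 2-subgroup of G, and Q a subgroup of P that is normal in P. Then Q is a perfect code of G if and only if Q is a perfect code of P. -/
open Function in
/-- If an involution `ι` of the base preserves the cardinalities of the fibres of `π`, then it lifts
to an involution of the total space all of whose fixed points lie in fibres of odd cardinality. -/
theorem Function.exists_involutive_lift {α β : Type*} [Finite α] (π : α → β) {ι : β → β}
    (hι : Involutive ι)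
    (hcard : ∀ b, Nat.card {a // π a = ι b} = Nat.card {a // π a = b}) :
    ∃ σ : α → α, Involutive σ ∧ (∀ a, π (σ a) = ι (π a)) ∧
      ∀ a, σ a = a → Odd (Nat.card {x // π x = π a}) := by
  let n : β → ℕ := fun b ↦ Nat.card {a // π a = b}
  have hn : ∀ b, n b = n (ι b) := fun b ↦ (hcard b).symm
  let e : α ≃ Σ b, Fin (n b) :=
    (Equiv.sigmaFiberEquiv π).symm.trans (Equiv.sigmaCongrRight fun b ↦ Finite.equivFin _)
  have he : ∀ a, (e a).1 = π a := fun a ↦ rfl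
  let τ : (Σ b, Fin (n b)) → Σ b, Fin (n b) := fun x ↦ ⟨ι x.1, Fin.cast (hn x.1) x.2.rev⟩
  have hext : ∀ x y : Σ b, Fin (n b), x.1 = y.1 → (x.2 : ℕ) = y.2 → x = y := by
    rintro ⟨b, i⟩ ⟨c, j⟩ h h'
    obtain rfl : b = c := h
    exact congrArg (Sigma.mk b) (Fin.ext h')
  have hτ : Involutive τ := by
    rintro ⟨b, i⟩
    refine hext _ _ (hι b) ?_
    simp only [τ, Fin.val_cast, Fin.val_rev]
    have := hn b
    omega
  refine ⟨fun a ↦ e.symm (τ (e a)), fun a ↦ by simp [hτ (e a)], fun a ↦ ?_, fun a ha ↦ ?_⟩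
  · rw [← he, Equiv.apply_symm_apply, ← he]
  · rw [Equiv.symm_apply_eq] at ha
    have h : ((τ (e a)).2 : ℕ) = (e a).2 := by rw [ha]
    simp only [τ, Fin.val_cast, Fin.val_rev] at h
    change Odd (n (e a).1)
    exact ⟨(e a).2, by omega⟩

namespace Subgroup

variable {G : Type*} [Group G] {H : Subgroup G}

theorem isPerfectCode_of_section (t : G ⧸ H → G) (ht : ∀ c, (t c : G ⧸ H) = c)
    (hinv : ∀ c, ∃ d, (t c)⁻¹ = t d) : H.IsPerfectCode := by
  have hmem : ∀ x ∈ Set.range t, x⁻¹ ∈ Set.range t := by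
    rintro _ ⟨c, rfl⟩
    obtain ⟨d, hd⟩ := hinv c
    exact ⟨d, hd.symm⟩
  refine ⟨Set.range t, Set.ext fun x ↦ ⟨fun hx ↦ by simpa using hmem _ hx, hmem x⟩, ?_⟩
  rw [isComplement_iff_existsUnique_mul_inv_mem]
  intro g
  obtain ⟨y, hy⟩ := hmem _ ⟨(g⁻¹ : G), rfl⟩
  have key : ∀ c, g * t c ∈ H ↔ c = (g⁻¹ : G) := fun c ↦ by
    conv_rhs => rw [← ht c, eq_comm, QuotientGroup.eq, inv_inv]
  refine ⟨⟨t y, y, rfl⟩, ?_, ?_⟩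
  · simp [hy, key]
  · rintro ⟨_, c, rfl⟩ hc
    obtain ⟨d, hd⟩ := hinv c
    have hd' : d = (g⁻¹ : G) := by
      rw [← key, ← hd]
      exact hc
    apply Subtype.ext
    change t c = t y
    rw [← inv_inj, hd, hy, hd', inv_inv]

theorem isPerfectCode_of_involutive {σ : G ⧸ H → G ⧸ H} (hσ : Function.Involutive σ)
    (h : ∀ c, ∃ s : G, (s : G ⧸ H) = c ∧ ((s⁻¹ : G) : G ⧸ H) = σ c ∧ (σ c = c → s⁻¹ = s)) :
    H.IsPerfectCode := by
  classical
  choose s hs hs' hfix using h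
  let _ : LinearOrder (G ⧸ H) := linearOrderOfSTO WellOrderingRel
  refine isPerfectCode_of_section (fun c ↦ if c ≤ σ c then s c else (s (σ c))⁻¹) (fun c ↦ ?_)
    fun c ↦ ⟨σ c, ?_⟩
  · split_ifs
    · exact hs c
    · rw [hs', hσ]
  · simp only [hσ c]
    rcases lt_trichotomy c (σ c) with hc | hc | hc
    · simp [hc.le, hc.not_ge]
    · simp [← hc, hfix c hc.symm]
    · simp [hc.le, hc.not_ge]

/-- The double coset `HgH` attached to a left coset `gH`. -/
def doubleCosetOfQuotient (H : Subgroup G) : G ⧸ H → Set G :=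
  Quotient.lift (fun g ↦ DoubleCoset.doubleCoset g (H : Set G) H) fun a b hab ↦ by
    refine (DoubleCoset.doubleCoset_eq_of_mem ?_).symm
    rw [DoubleCoset.mem_doubleCoset]
    exact ⟨1, H.one_mem, a⁻¹ * b, QuotientGroup.leftRel_apply.mp hab, by group⟩

theorem doubleCosetOfQuotient_mk (g : G) :
    H.doubleCosetOfQuotient g = DoubleCoset.doubleCoset g (H : Set G) H := rfl

open scoped Pointwise in
theorem doubleCosetOfQuotient_inv (g : G) :
    H.doubleCosetOfQuotient (g⁻¹ : G) = (H.doubleCosetOfQuotient g)⁻¹ := by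
  simp_rw [doubleCosetOfQuotient_mk, DoubleCoset.doubleCoset, mul_inv_rev, inv_coe_set,
    Set.inv_singleton, mul_assoc]

theorem doubleCosetOfQuotient_eq_iff {a b : G} :
    H.doubleCosetOfQuotient a = H.doubleCosetOfQuotient b ↔
      ∃ x ∈ H, ∃ y ∈ H, a = x * b * y := by
  rw [doubleCosetOfQuotient_mk, doubleCosetOfQuotient_mk]
  refine ⟨fun h ↦ ?_, fun h ↦ DoubleCoset.doubleCoset_eq_of_mem (DoubleCoset.mem_doubleCoset.2 h)⟩
  have := DoubleCoset.mem_doubleCoset_self H H a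
  rw [h] at this
  exact DoubleCoset.mem_doubleCoset.1 this

theorem card_fiber_doubleCosetOfQuotient_inv [Finite G] (D : Set G) :
    Nat.card {c // H.doubleCosetOfQuotient c = D⁻¹} =
      Nat.card {c // H.doubleCosetOfQuotient c = D} := by
  have key : ∀ E : Set G, Nat.card {g : G // H.doubleCosetOfQuotient g = E} =
      Nat.card H * Nat.card {c // H.doubleCosetOfQuotient c = E} := fun E ↦ by
    rw [← Nat.card_prod]
    exact Nat.card_congr
      (QuotientGroup.preimageMkEquivSubgroupProdSet H {c | H.doubleCosetOfQuotient c = E})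
  apply Nat.eq_of_mul_eq_mul_left (Nat.card_pos (α := H))
  rw [← key, ← key]
  refine Nat.card_congr ((Equiv.inv G).subtypeEquiv fun g ↦ ?_)
  rw [Equiv.inv_apply, doubleCosetOfQuotient_inv, inv_eq_iff_eq_inv]

theorem fiber_doubleCosetOfQuotient (g : G) :
    {c | H.doubleCosetOfQuotient c = H.doubleCosetOfQuotient g} =
      MulAction.orbit H (g : G ⧸ H) := by
  ext c
  induction c using QuotientGroup.induction_on with
  | H a =>
    rw [Set.mem_ofPred_eq, doubleCosetOfQuotient_eq_iff, MulAction.mem_orbit_iff]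
    constructor
    · rintro ⟨x, hx, y, hy, rfl⟩
      refine ⟨⟨x, hx⟩, ?_⟩
      change ((x * g : G) : G ⧸ H) = _
      simpa [QuotientGroup.eq, mul_assoc] using hy
    · rintro ⟨x, hx⟩
      change ((x * g : G) : G ⧸ H) = _ at hx
      exact ⟨x, x.2, _, QuotientGroup.eq.1 hx, by group⟩

theorem mem_normalizer_of_odd_card_fiber [Finite G] (hH : IsPGroup 2 H) {g : G}
    (h : Odd (Nat.card {c // H.doubleCosetOfQuotient c = H.doubleCosetOfQuotient g})) :
    g ∈ normalizer (H : Set G) := by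
  change Odd (Nat.card {c | H.doubleCosetOfQuotient c = H.doubleCosetOfQuotient g}) at h
  rw [fiber_doubleCosetOfQuotient] at h
  obtain ⟨n, hn⟩ := hH.card_orbit (g : G ⧸ H)
  obtain rfl : n = 0 := by
    by_contra h0
    rw [hn, Nat.odd_pow_iff h0] at h
    exact absurd h (by decide)
  rw [pow_zero] at hn
  have := Fintype.ofFinite (MulAction.orbit H (g : G ⧸ H))
  rwa [← Sylow.mem_fixedPoints_mul_left_cosets_iff_mem_normalizer,
    MulAction.mem_fixedPoints_iff_card_orbit_eq_one, ← Nat.card_eq_fintype_card]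

/-- For a finite 2-subgroup, being a perfect code is a condition on its normalizer. -/
theorem isPerfectCode_iff_of_isPGroup_two [Finite G] (hH : IsPGroup 2 H) :
    H.IsPerfectCode ↔ ∀ g ∈ normalizer (H : Set G), g ^ 2 ∈ H →
      ∃ s : G, g⁻¹ * s ∈ H ∧ s ^ 2 = 1 := by
  constructor
  · rintro ⟨T, hT, hHT⟩ g hg hg2
    obtain ⟨⟨⟨h, hh⟩, ⟨t, ht⟩⟩, rfl : h * t = g⟩ := hHT.2 g
    have htn : t ∈ normalizer (H : Set G) := by
      simpa using mul_mem (inv_mem (le_normalizer hh)) hg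
    have hht : t * h * t⁻¹ ∈ H := (mem_normalizer_iff.1 htn h).1 hh
    have ht2 : t * t ∈ H := by
      have : t * t = (t * h * t⁻¹)⁻¹ * (h⁻¹ * (h * t) ^ 2) := by simp [pow_two, mul_assoc]
      rw [this]
      exact mul_mem (inv_mem hht) (mul_mem (inv_mem hh) hg2)
    refine ⟨t, ?_, ?_⟩
    · have := (mem_normalizer_iff''.1 htn _).1 (inv_mem hh)
      simpa [mul_assoc] using this
    · have h1 := @hHT.1 (⟨t * t, ht2⟩, ⟨t⁻¹, by rw [← hT]; simpa using ht⟩)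
        (⟨1, H.one_mem⟩, ⟨t, ht⟩) (by simp)
      simpa [pow_two] using congrArg (fun p ↦ (p.1 : G)) h1
  · intro hN
    obtain ⟨σ, hσ, hlift, hodd⟩ := Function.exists_involutive_lift H.doubleCosetOfQuotient
      inv_involutive card_fiber_doubleCosetOfQuotient_inv
    refine isPerfectCode_of_involutive hσ fun c ↦ ?_
    obtain ⟨a, rfl⟩ := QuotientGroup.mk_surjective c
    obtain ⟨b, hb⟩ := QuotientGroup.mk_surjective (σ a)
    have hab := hlift a
    rw [← hb, ← doubleCosetOfQuotient_inv, doubleCosetOfQuotient_eq_iff] at hab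
    obtain ⟨x, hx, y, hy, rfl⟩ := hab
    rw [← hb]
    by_cases hfix : σ a = a
    · have hn := mem_normalizer_of_odd_card_fiber hH (hodd a hfix)
      have h2 : a ^ 2 ∈ H := by
        rw [← hb, QuotientGroup.eq] at hfix
        have h3 : a ^ 2 = (a * x * a⁻¹) * (y * ((x * a⁻¹ * y)⁻¹ * a)) := by
          simp [pow_two, mul_assoc]
        rw [h3]
        exact mul_mem ((mem_normalizer_iff.1 hn x).1 hx) (mul_mem hy hfix)
      obtain ⟨s, hs, hs2⟩ := hN a hn h2
      have hinv : s⁻¹ = s := by rw [inv_eq_iff_mul_eq_one, ← pow_two, hs2]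
      have hsa : (s : G ⧸ H) = a := (QuotientGroup.eq.2 hs).symm
      exact ⟨s, hsa, by rw [hinv, hsa, hb, hfix], fun _ ↦ hinv⟩
    · refine ⟨a * x⁻¹, ?_, ?_, fun h ↦ absurd (hb.symm.trans h) hfix⟩
      · simpa [QuotientGroup.eq] using hx
      · simpa [QuotientGroup.eq, mul_assoc] using hy

end Subgroup

open Subgroup in
theorem Sylow.exists_conj_mem_of_pow_mem {G : Type*} [Group G] [Finite G] {p : ℕ} [Fact p.Prime]
    (P : Sylow p G) {x : G} {k : ℕ} (hx : x ^ p ^ k = 1) : ∃ g : G, g * x * g⁻¹ ∈ P := by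
  have hp : IsPGroup p (zpowers x) := by
    rintro ⟨_, m, rfl⟩
    refine ⟨k, Subtype.ext ?_⟩
    change (x ^ m) ^ p ^ k = 1
    rw [← zpow_natCast, zpow_comm, zpow_natCast, hx, one_zpow]
  obtain ⟨S, hS⟩ := hp.exists_le_sylow
  obtain ⟨g, rfl⟩ := MulAction.exists_smul_eq G S P
  refine ⟨g, ?_⟩
  exact Subgroup.smul_mem_pointwise_smul x (MulAut.conj g) _ (hS (mem_zpowers x))

theorem normal_in_sylow_isPerfectCode_iff {G : Type*} [Group G] [Finite G]
    (P : Sylow 2 G) (Q : Subgroup G) (hQP : Q ≤ (P : Subgroup G))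
    (hnorm : (Q.subgroupOf (P : Subgroup G)).Normal) :
    Q.IsPerfectCode ↔ (Q.subgroupOf (P : Subgroup G)).IsPerfectCode := by
  have hQ : IsPGroup 2 Q := P.isPGroup'.to_le hQP
  have hPN : (P : Subgroup G) ≤ Subgroup.normalizer (Q : Set G) :=
    Subgroup.normal_subgroupOf_iff_le_normalizer hQP |>.1 hnorm
  rw [Subgroup.isPerfectCode_iff_of_isPGroup_two hQ,
    Subgroup.isPerfectCode_iff_of_isPGroup_two (P.isPGroup'.to_subgroup _)]
  constructor
  · intro h g _ hg2
    obtain ⟨s, hs, hs2⟩ := h g (hPN g.2) hg2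
    have hsP : s ∈ (P : Subgroup G) := by
      simpa using mul_mem g.2 (hQP hs)
    exact ⟨⟨s, hsP⟩, hs, Subtype.ext hs2⟩
  · intro h g hg hg2
    obtain ⟨k, hk⟩ := hQ ⟨g ^ 2, hg2⟩
    have hk' : (⟨g, hg⟩ : Subgroup.normalizer (Q : Set G)) ^ 2 ^ (k + 1) = 1 := by
      apply Subtype.ext
      have := congrArg Subtype.val hk
      simpa [pow_succ', pow_mul] using this
    obtain ⟨⟨n, hn⟩, hng⟩ := (P.subtype hPN).exists_conj_mem_of_pow_mem hk'
    replace hng : n * g * n⁻¹ ∈ (P : Subgroup G) := hng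
    have hconj : ∀ q, q ∈ Q ↔ n * q * n⁻¹ ∈ Q := Subgroup.mem_normalizer_iff.1 hn
    obtain ⟨⟨s, hsP⟩, hs, hs2⟩ := h ⟨_, hng⟩ (by rw [Subgroup.normalizer_eq_top]; trivial) (by
      change (n * g * n⁻¹) ^ 2 ∈ Q
      rw [conj_pow]
      exact (hconj _).1 hg2)
    replace hs : (n * g * n⁻¹)⁻¹ * s ∈ Q := hs
    replace hs2 : s ^ 2 = 1 := congrArg Subtype.val hs2
    refine ⟨n⁻¹ * s * n, ?_, ?_⟩
    · rw [hconj]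
      simpa [mul_assoc] using hs
    · have := conj_pow (a := n⁻¹) (b := s) (i := 2)
      rw [inv_inv] at this
      simp [this, hs2]
end

section
/- Let G be a finite metabelian group (i.e., the commutator subgroup of G is abelian) and H a normal subgroup of G. Then H is a perfect code of G if and only if there exists a Sylow 2-subgroup of H which is a perfect code of G. -/
open Subgroup MulAction

theorem exists_inv_closed_transversal {G X Y : Type*} [Group G] (q : G → X) (p : X → Y)
    {ι : Y → Y} (hι : Function.Involutive ι)
    (hq : ∀ c d, p d = ι (p c) → ∃ g, q g = c ∧ q g⁻¹ = d) (S : Set X) (hS : S.Finite)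
    (hcard : ∀ y, (S ∩ p ⁻¹' {y}).ncard = (S ∩ p ⁻¹' {ι y}).ncard)
    (hodd : ∀ c ∈ S, ι (p c) = p c → Odd (S ∩ p ⁻¹' {p c}).ncard → ∃ g, g⁻¹ = g ∧ q g = c) :
    ∃ T : Set G, T⁻¹ = T ∧ (∀ t ∈ T, q t ∈ S) ∧ ∀ c ∈ S, ∃! t, t ∈ T ∧ q t = c := by
  classical
  induction hn : S.ncard using Nat.strong_induction_on generalizing S with
  | _ n ih =>
  subst hn
  have hfin : ∀ y, (S ∩ p ⁻¹' {y}).Finite := fun y ↦ hS.inter_of_left _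
  have hrem : ∀ (A : Set X) c y, A.Finite → c ∈ A →
      (A ∩ p ⁻¹' {y}).ncard = ((A \ {c}) ∩ p ⁻¹' {y}).ncard + if p c = y then 1 else 0 := by
    intro A c y hA hc
    rw [Set.sdiff_inter_right_comm]
    split_ifs with h
    · exact (Set.ncard_sdiff_singleton_add_one (show c ∈ A ∩ p ⁻¹' {y} from ⟨hc, h⟩)
        (hA.inter_of_left _)).symm
    · rw [Set.sdiff_singleton_eq_self (fun h' ↦ h h'.2), add_zero]
  rcases S.eq_empty_or_nonempty with rfl | ⟨c, hc⟩
  · exact ⟨∅, by simp⟩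
  by_cases hd : ∃ d ∈ S, d ≠ c ∧ p d = ι (p c)
  · obtain ⟨d, hdS, hdc, hpd⟩ := hd
    have hpc : p c = ι (p d) := by rw [hpd, hι]
    obtain ⟨g, rfl, rfl⟩ := hq c d hpd
    have hcount : ∀ y, (S ∩ p ⁻¹' {y}).ncard = ((S \ {q g}) \ {q g⁻¹} ∩ p ⁻¹' {y}).ncard
        + (if p (q g⁻¹) = y then 1 else 0) + if p (q g) = y then 1 else 0 := by
      intro y
      rw [hrem S _ y hS hc, hrem (S \ {q g}) _ y hS.sdiff ⟨hdS, hdc⟩]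
    obtain ⟨T, hT, hTS, hTu⟩ := ih ((S \ {q g}) \ {q g⁻¹}).ncard
      (Set.ncard_lt_ncard (Set.ssubset_of_subset_of_ssubset Set.sdiff_subset
        (Set.sdiff_singleton_ssubset.2 hc)) hS) _ hS.sdiff.sdiff
      (by
        intro y
        have h1 := hcount y
        have h2 := hcount (ι y)
        rw [hcard y] at h1
        have e1 : p (q g⁻¹) = y ↔ p (q g) = ι y := by rw [hpd]; exact hι.eq_iff
        have e2 : p (q g) = y ↔ p (q g⁻¹) = ι y := by rw [hpc]; exact hι.eq_iff
        simp only [e1, e2] at h1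
        omega)
      (by
        intro e he hpe ho
        refine hodd e he.1.1 hpe ?_
        rw [hcount]
        have : p (q g⁻¹) = p e ↔ p (q g) = p e := by rw [hpd, hι.eq_iff, hpe]
        simp only [this]
        split_ifs
        · simpa [add_assoc] using ho.add_even even_two
        · simpa using ho) rfl
    refine ⟨insert g (insert g⁻¹ T), ?_, ?_, ?_⟩
    · rw [Set.inv_insert, Set.inv_insert, hT, inv_inv, Set.insert_comm]
    · rintro t (rfl | rfl | ht)
      exacts [hc, hdS, (hTS t ht).1.1]
    · intro e he
      by_cases h1 : e = q g
      · subst h1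
        refine ⟨g, ⟨by simp, rfl⟩, ?_⟩
        rintro t ⟨rfl | rfl | ht, hte⟩
        exacts [rfl, absurd hte hdc, absurd hte (hTS t ht).1.2]
      by_cases h2 : e = q g⁻¹
      · subst h2
        refine ⟨g⁻¹, ⟨by simp, rfl⟩, ?_⟩
        rintro t ⟨rfl | rfl | ht, hte⟩
        exacts [absurd hte.symm hdc, rfl, absurd hte (hTS t ht).2]
      obtain ⟨t, ⟨ht, hte⟩, hu⟩ := hTu e ⟨⟨he, h1⟩, h2⟩
      refine ⟨t, ⟨by simp [ht], hte⟩, ?_⟩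
      rintro s ⟨rfl | rfl | hs, hse⟩
      exacts [absurd hse.symm h1, absurd hse.symm h2, hu s ⟨hs, hse⟩]
  · push Not at hd
    have hpos : 0 < (S ∩ p ⁻¹' {ι (p c)}).ncard := by
      rw [← hcard]
      exact (Set.ncard_pos (hfin _)).2 ⟨c, hc, rfl⟩
    obtain ⟨d, hdS, hpd⟩ := (Set.ncard_pos (hfin _)).1 hpos
    have hdc : d = c := by
      by_contra h
      exact hd d hdS h hpd
    subst hdc
    have hpd : p d = ι (p d) := hpd
    have hsing : S ∩ p ⁻¹' {p d} = {d} := by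
      ext e
      refine ⟨fun ⟨he, hpe⟩ ↦ ?_, ?_⟩
      · by_contra h
        exact hd e he h (hpd ▸ hpe)
      · rintro rfl
        exact ⟨hdS, rfl⟩
    obtain ⟨g, hg, rfl⟩ := hodd d hdS hpd.symm (by simp [hsing])
    obtain ⟨T, hT, hTS, hTu⟩ := ih (S \ {q g}).ncard
      (Set.ncard_lt_ncard (Set.sdiff_singleton_ssubset.2 hdS) hS) _ hS.sdiff
      (by
        intro y
        have h1 := hrem S _ y hS hdS
        have h2 := hrem S _ (ι y) hS hdS
        rw [hcard y] at h1
        have e1 : p (q g) = y ↔ p (q g) = ι y := by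
          conv_lhs => rw [hpd]
          exact hι.eq_iff
        simp only [e1] at h1
        omega)
      (by
        intro e he hpe ho
        refine hodd e he.1 hpe ?_
        rw [hrem S _ _ hS hdS, if_neg, add_zero]
        · exact ho
        · intro h
          have : e ∈ S ∩ p ⁻¹' {p (q g)} := ⟨he.1, h.symm⟩
          rw [hsing] at this
          exact he.2 this) rfl
    refine ⟨insert g T, by rw [Set.inv_insert, hT, hg], ?_, ?_⟩
    · rintro t (rfl | ht)
      exacts [hdS, (hTS t ht).1]
    · intro e he
      by_cases h1 : e = q g
      · subst h1
        refine ⟨g, ⟨by simp, rfl⟩, ?_⟩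
        rintro t ⟨rfl | ht, hte⟩
        exacts [rfl, absurd hte (hTS t ht).2]
      obtain ⟨t, ⟨ht, hte⟩, hu⟩ := hTu e ⟨he, h1⟩
      refine ⟨t, ⟨by simp [ht], hte⟩, ?_⟩
      rintro s ⟨rfl | hs, hse⟩
      exacts [absurd hse.symm h1, hu s ⟨hs, hse⟩]

theorem Subgroup.IsPerfectCode.exists_sq_eq_one {G : Type*} [Group G] {H : Subgroup G}
    (hH : H.IsPerfectCode) {x : G} (hx : x ∈ normalizer (H : Set G)) (hx2 : x ^ 2 ∈ H) :
    ∃ y, y ^ 2 = 1 ∧ y * x⁻¹ ∈ H := by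
  obtain ⟨T, hT, hc⟩ := hH
  rw [isComplement_iff_existsUnique_mul_inv_mem] at hc
  obtain ⟨⟨t, ht⟩, htx, hu⟩ := hc x
  have htx : x * t⁻¹ ∈ H := htx
  have ht' : t⁻¹ ∈ T := by rwa [← hT, Set.inv_mem_inv]
  have key : x * t⁻¹⁻¹ ∈ H := by
    have h1 : x⁻¹ * (x * t⁻¹)⁻¹ * x ∈ H := (mem_normalizer_iff''.1 hx _).1 (H.inv_mem htx)
    have h2 := H.mul_mem hx2 h1
    convert! h2 using 1
    simp only [pow_two]
    group
  have htt : t⁻¹ = t := congrArg Subtype.val (hu ⟨t⁻¹, ht'⟩ key)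
  refine ⟨t, by rw [pow_two, ← mul_inv_cancel t, htt], ?_⟩
  simpa using H.inv_mem htx

theorem Subgroup.isPerfectCode_of_forall_exists_sq_eq_one {G : Type*} [Group G] [Finite G]
    {H : Subgroup G}
    (hodd : ∀ x : G, Odd (orbit H (x : G ⧸ H)).ncard → x ∈ normalizer (H : Set G))
    (hH : ∀ x ∈ normalizer (H : Set G), x ^ 2 ∈ H → ∃ y, y ^ 2 = 1 ∧ y * x⁻¹ ∈ H) :
    H.IsPerfectCode := by
  let q : G → G ⧸ H := QuotientGroup.mk
  let p : G ⧸ H → Set G := fun c ↦ {g | (g : G ⧸ H) ∈ orbit H c}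
  have hmem : ∀ a b : G, a ∈ p (q b) ↔ ∃ h ∈ H, ∃ k ∈ H, a = h * b * k := by
    intro a b
    constructor
    · rintro ⟨⟨h, hh⟩, hab⟩
      have hab : ((h * b : G) : G ⧸ H) = a := hab
      rw [QuotientGroup.eq] at hab
      exact ⟨h, hh, _, hab, by group⟩
    · rintro ⟨h, hh, k, hk, rfl⟩
      refine ⟨⟨h, hh⟩, ?_⟩
      change ((h * b : G) : G ⧸ H) = ((h * b * k : G) : G ⧸ H)
      rw [QuotientGroup.eq]
      rwa [inv_mul_cancel_left]
  have hpinv : ∀ g, p (q g⁻¹) = (p (q g))⁻¹ := by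
    intro g
    ext a
    rw [Set.mem_inv, hmem, hmem]
    constructor
    · rintro ⟨h, hh, k, hk, rfl⟩
      exact ⟨k⁻¹, H.inv_mem hk, h⁻¹, H.inv_mem hh, by group⟩
    · rintro ⟨h, hh, k, hk, ha⟩
      exact ⟨k⁻¹, H.inv_mem hk, h⁻¹, H.inv_mem hh, by rw [← inv_inv a, ha]; group⟩
  have hself : ∀ g, g ∈ p (q g) := fun g ↦ mem_orbit_self _
  have hfib : ∀ c, p ⁻¹' {p c} = orbit H c := by
    intro c
    ext d
    rw [← orbit_eq_iff]
    constructor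
    · intro h
      obtain ⟨a, rfl⟩ := QuotientGroup.mk_surjective d
      have : a ∈ p c := (show p (q a) = p c from h) ▸ hself a
      exact orbit_eq_iff.2 this
    · intro h
      change {g : G | _ ∈ orbit H d} = {g : G | _ ∈ orbit H c}
      rw [h]
  have hfibcard : ∀ y, {g | p (q g) = y}.ncard = Nat.card H * (p ⁻¹' {y}).ncard := by
    intro y
    rw [← Nat.card_coe_set_eq, ← Nat.card_coe_set_eq, ← Nat.card_prod]
    exact Nat.card_congr (QuotientGroup.preimageMkEquivSubgroupProdSet H (p ⁻¹' {y}))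
  have hcard : ∀ y, (p ⁻¹' {y}).ncard = (p ⁻¹' {y⁻¹}).ncard := by
    intro y
    refine Nat.eq_of_mul_eq_mul_left (Nat.card_pos (α := H)) ?_
    rw [← hfibcard, ← hfibcard, ← Set.ncard_inv]
    congr 1
    ext g
    simp [hpinv, inv_eq_iff_eq_inv]
  obtain ⟨T, hT, -, hTu⟩ := exists_inv_closed_transversal q p (ι := fun y ↦ y⁻¹) inv_involutive
    (by
      intro c d hcd
      obtain ⟨a, rfl⟩ := QuotientGroup.mk_surjective c
      obtain ⟨b, rfl⟩ := QuotientGroup.mk_surjective d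
      have hb : b⁻¹ ∈ p (q a) := by
        rw [← Set.mem_inv]
        exact hcd ▸ hself b
      obtain ⟨h, hh, k, hk, hb⟩ := (hmem _ _).1 hb
      refine ⟨a * k, ?_, ?_⟩
      · exact QuotientGroup.mk_mul_of_mem _ hk
      · have : (a * k)⁻¹ = b * h := by
          rw [eq_comm, ← mul_eq_one_iff_eq_inv, mul_assoc b, ← mul_assoc h, ← hb, mul_inv_cancel]
        rw [this]
        exact QuotientGroup.mk_mul_of_mem _ hh)
    Set.univ Set.finite_univ (by simpa using hcard)
    (by
      intro c _ hpc ho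
      obtain ⟨x, rfl⟩ := QuotientGroup.mk_surjective c
      rw [Set.univ_inter, hfib] at ho
      have hxN := hodd x ho
      have hx : x⁻¹ ∈ p (q x) := by
        rw [← Set.mem_inv]
        exact hpc.symm ▸ hself x
      obtain ⟨h, hh, k, hk, hx⟩ := (hmem _ _).1 hx
      have hx2 : x ^ 2 ∈ H := by
        have h1 : x * h * x = k⁻¹ := by
          rw [← mul_eq_one_iff_eq_inv, mul_assoc, mul_assoc, ← mul_assoc h, ← hx, mul_inv_cancel]
        have h2 : x ^ 2 = (x * h * x⁻¹)⁻¹ * (x * h * x) := by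
          rw [pow_two]
          group
        rw [h2, h1]
        exact H.mul_mem (H.inv_mem ((mem_normalizer_iff.1 hxN _).1 hh)) (H.inv_mem hk)
      obtain ⟨y, hy, hyx⟩ := hH x hxN hx2
      refine ⟨y, inv_eq_of_mul_eq_one_left (by rw [← pow_two, hy]), ?_⟩
      refine (QuotientGroup.eq.2 ?_).symm
      have := (mem_normalizer_iff''.1 hxN _).1 hyx
      simpa [mul_assoc] using this)
  refine ⟨T, hT, ?_⟩
  rw [isComplement_iff_existsUnique_mul_inv_mem]
  intro g
  obtain ⟨t, ⟨ht, htg⟩, hu⟩ := hTu (q g⁻¹) trivial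
  have hinv : ∀ s ∈ T, s⁻¹ ∈ T := fun s hs ↦ by rwa [← hT, Set.inv_mem_inv]
  refine ⟨⟨t⁻¹, hinv t ht⟩, ?_, ?_⟩
  · simpa using QuotientGroup.eq.1 htg.symm
  · rintro ⟨s, hs⟩ hsg
    rw [Subtype.mk.injEq, ← hu s⁻¹ ⟨hinv s hs, ?_⟩, inv_inv]
    refine (QuotientGroup.eq.2 ?_).symm
    simpa using hsg

theorem IsPGroup.mem_normalizer_of_odd_ncard_orbit {G : Type*} [Group G] [Finite G]
    {P : Subgroup G} (hP : IsPGroup 2 P) (x : G) (hx : Odd (orbit P (x : G ⧸ P)).ncard) :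
    x ∈ normalizer (P : Set G) := by
  obtain ⟨n, hn⟩ := hP.card_orbit (x : G ⧸ P)
  rw [Nat.card_coe_set_eq] at hn
  have hn0 : n = 0 := by
    by_contra h
    rw [hn, Nat.odd_pow_iff h] at hx
    exact absurd hx (by decide)
  rw [hn0, pow_zero, Set.ncard_eq_one] at hn
  obtain ⟨c, hc⟩ := hn
  have hfix : ∀ h ∈ P, x⁻¹ * h * x ∈ P := by
    intro h hh
    have h1 : (x : G ⧸ P) = c := by
      rw [← Set.mem_singleton_iff, ← hc]
      exact mem_orbit_self _
    have h2 : ((h * x : G) : G ⧸ P) = c := by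
      rw [← Set.mem_singleton_iff, ← hc]
      exact ⟨⟨h, hh⟩, rfl⟩
    rw [mul_assoc]
    exact QuotientGroup.eq.1 (h1.trans h2.symm)
  rw [← inv_mem_iff]
  exact mem_normalizer_fintype fun h hh ↦ by simpa using hfix h hh

theorem conj_pow_eq_of_sq_eq_one {G : Type*} [Group G] {x y : G} (hx : x ^ 2 = 1) (hy : y ^ 2 = 1)
    {j : ℕ} (h : (y * x) ^ (2 * j + 1) = 1) : (y * x) ^ j * y * ((y * x) ^ j)⁻¹ = x := by
  have hx' : x⁻¹ = x := inv_eq_of_mul_eq_one_left (by rw [← pow_two, hx])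
  have hy' : y⁻¹ = y := inv_eq_of_mul_eq_one_left (by rw [← pow_two, hy])
  have hs : SemiconjBy y (y * x)⁻¹ (y * x) := by
    simp only [SemiconjBy, mul_inv_rev, hx', hy', mul_assoc]
  have hs' : y * ((y * x) ^ j)⁻¹ = (y * x) ^ j * y := by
    rw [← inv_pow]
    exact (hs.pow_right j).eq
  rw [mul_assoc, hs', ← mul_assoc, ← pow_add, ← two_mul]
  rw [pow_succ, ← mul_assoc] at h
  calc (y * x) ^ (2 * j) * y = x⁻¹ := mul_eq_one_iff_eq_inv.1 h
    _ = x := hx'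

namespace Sylow

variable {G : Type*} [Group G] {H : Subgroup G}

theorem exists_odd_pow_mem_map [Finite G] (Q : Sylow 2 H) {k : G} (hk : k ∈ H)
    (hkN : k ∈ normalizer ((Q : Subgroup H).map H.subtype : Set G)) :
    ∃ m, Odd m ∧ k ^ m ∈ (Q : Subgroup H).map H.subtype := by
  have hN : (⟨k, hk⟩ : H) ∈ normalizer ((Q : Subgroup H) : Set H) := by
    rw [mem_normalizer_iff]
    intro h
    have := mem_normalizer_iff.1 hkN h
    rw [← mem_map_iff_mem H.subtype_injective, ← mem_map_iff_mem H.subtype_injective]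
    exact this
  let N := normalizer ((Q : Subgroup H) : Set H)
  refine ⟨(Q : Subgroup H).relIndex N, ?_, ?_⟩
  · rw [← Nat.not_even_iff_odd, even_iff_two_dvd]
    exact fun h ↦ Q.not_dvd_index (h.trans (relIndex_dvd_index_of_le le_normalizer))
  · have := ((Q : Subgroup H).subgroupOf N).pow_index_mem ⟨⟨k, hk⟩, hN⟩
    exact ⟨_, this, rfl⟩

theorem exists_conj_mem_normalizer_map [Finite G] [H.Normal] (Q : Sylow 2 H) {y : G}
    (hy : y ^ 2 = 1) :
    ∃ h ∈ H, h * y * h⁻¹ ∈ normalizer ((Q : Subgroup H).map H.subtype : Set G) := by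
  let f : MulAut H := MulAut.conjNormal y
  have hf : f ^ 2 = 1 := by rw [← map_pow, hy, map_one]
  have hp : IsPGroup 2 (zpowers f) := by
    refine IsPGroup.of_card_dvd_pow (n := 1) ?_
    rw [Nat.card_zpowers, pow_one]
    exact orderOf_dvd_of_pow_eq_one hf
  obtain ⟨R, hR⟩ := hp.nonempty_fixed_point_of_prime_not_dvd_card (Sylow 2 H)
    (not_dvd_card_sylow 2 H)
  have hR : f • R = R := hR ⟨f, mem_zpowers f⟩
  obtain ⟨h, hh⟩ := exists_smul_eq H R Q
  refine ⟨h, h.2, ?_⟩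
  have hQ : (MulAut.conjNormal ((h : G) * y * (h : G)⁻¹) : MulAut H) • Q = Q := by
    have hRQ : (MulAut.conjNormal (h : G) : MulAut H) • R = Q := by
      rw [MulAut.conjNormal_val]
      exact hh
    rw [map_mul, map_mul, map_inv, mul_smul, mul_smul, inv_smul_eq_iff.2 hRQ.symm]
    exact (congrArg _ hR).trans hRQ
  rw [mem_normalizer_iff_map_conj_eq]
  conv_rhs => rw [← congrArg (fun P : Sylow 2 H ↦ (P : Subgroup H)) hQ]
  rw [pointwise_smul_def, Subgroup.pointwise_smul_def, map_map]
  exact (map_map (Q : Subgroup H) H.subtype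
    (MulAut.conjNormal ((h : G) * y * (h : G)⁻¹) : MulAut H).toMonoidHom).symm

theorem isPerfectCode_map_iff [Finite G] (Q : Sylow 2 H) :
    ((Q : Subgroup H).map H.subtype).IsPerfectCode ↔
      ∀ x ∈ normalizer ((Q : Subgroup H).map H.subtype : Set G),
        x ^ 2 ∈ (Q : Subgroup H).map H.subtype →
          ∃ y, y ^ 2 = 1 ∧ y * x⁻¹ ∈ (Q : Subgroup H).map H.subtype :=
  ⟨fun h _ hx hx2 ↦ h.exists_sq_eq_one hx hx2,
    isPerfectCode_of_forall_exists_sq_eq_one (Q.2.map H.subtype).mem_normalizer_of_odd_ncard_orbit⟩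

end Sylow

theorem metabelian_normal_isPerfectCode_iff {G : Type*} [Group G] [Finite G]
    (hm : ∀ a b : commutator G, a * b = b * a)
    (H : Subgroup G) [H.Normal] :
    H.IsPerfectCode ↔
      ∃ Q : Sylow 2 H, ((Q : Subgroup H).map H.subtype).IsPerfectCode := by
  constructor
  · intro hH
    obtain ⟨Q⟩ : Nonempty (Sylow 2 H) := inferInstance
    refine ⟨Q, Q.isPerfectCode_map_iff.2 fun x hxN hx2 ↦ ?_⟩
    set P := (Q : Subgroup H).map H.subtype with hP
    have hPH : P ≤ H := map_subtype_le _
    obtain ⟨y, hy, hyx⟩ := hH.exists_sq_eq_one (x := x) (by simp [normalizer_eq_top]) (hPH hx2)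
    obtain ⟨h, hh, hyN⟩ := Q.exists_conj_mem_normalizer_map hy
    rw [← hP] at hyN
    set z := h * y * h⁻¹ with hz
    have hz2 : z ^ 2 = 1 := by rw [hz, conj_pow, hy, mul_one, mul_inv_cancel]
    have hzx : z * x ∈ H := by
      have h1 : z * x = h * (y * x⁻¹) * (x * h⁻¹ * x⁻¹) * x ^ 2 := by
        rw [hz, pow_two]
        group
      rw [h1]
      exact H.mul_mem (H.mul_mem (H.mul_mem hh hyx)
        (Normal.conj_mem inferInstance _ (H.inv_mem hh) x)) (hPH hx2)
    obtain ⟨m, ⟨j, rfl⟩, hj⟩ := Q.exists_odd_pow_mem_map hzx (mul_mem hyN hxN)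
    rw [← hP] at hj
    let N := normalizer (P : Set G)
    let x' : N := ⟨x, hxN⟩
    let z' : N := ⟨z, hyN⟩
    let π := QuotientGroup.mk' (P.subgroupOf N)
    have hπ : ∀ w : N, π w = 1 ↔ (w : G) ∈ P := fun w ↦ QuotientGroup.eq_one_iff w
    have key := conj_pow_eq_of_sq_eq_one (x := π x') (y := π z') (j := j)
      (by rw [← map_pow, hπ]; exact hx2)
      (by rw [← map_pow, hπ]; simp [z', hz2])
      (by rw [← map_mul, ← map_pow, hπ]; exact hj)
    refine ⟨(z * x) ^ j * z * ((z * x) ^ j)⁻¹, ?_, ?_⟩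
    · rw [conj_pow, hz2, mul_one, mul_inv_cancel]
    · rw [← mul_inv_eq_one, ← map_mul, ← map_pow, ← map_mul, ← map_inv, ← map_mul, ← map_inv,
        ← map_mul, hπ] at key
      exact key
  · rintro ⟨Q, hQ⟩
    refine isPerfectCode_of_forall_exists_sq_eq_one (fun x _ ↦ by simp [normalizer_eq_top])
      fun x _ hx2 ↦ ?_
    set P := (Q : Subgroup H).map H.subtype with hP
    have hPH : P ≤ H := map_subtype_le _
    have hx : x ∈ normalizer (P : Set G) ⊔ H := by
      rw [hP, Q.normalizer_sup_eq_top]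
      trivial
    obtain ⟨n, hn, h, hh, rfl⟩ := mem_sup_of_normal_right.1 hx
    have hn2 : n ^ 2 ∈ H := by
      rw [← QuotientGroup.eq_one_iff] at hx2 hh ⊢
      simpa [hh] using hx2
    obtain ⟨m, ⟨j, rfl⟩, hj⟩ := Q.exists_odd_pow_mem_map hn2 (pow_mem hn 2)
    obtain ⟨y, hy, hyn⟩ := hQ.exists_sq_eq_one (pow_mem hn (2 * j + 1))
      (by rwa [← pow_mul, mul_comm, pow_mul])
    refine ⟨y, hy, ?_⟩
    have hyH := hPH hyn
    rw [← QuotientGroup.eq_one_iff] at hyH hn2 hh ⊢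
    simp only [QuotientGroup.mk_mul, QuotientGroup.mk_inv, QuotientGroup.mk_pow] at *
    rw [pow_succ, pow_mul, hn2, one_pow, one_mul] at hyH
    rwa [hh, mul_one]
end

section
/- Let G be a finite nilpotent group and H a subgroup of G. Then H is a perfect code of G if and only if the (unique) Sylow 2-subgroup of H is a perfect code of G. -/
namespace Subgroup

/-- Unbundled form of being a perfect code: an inverse-closed set meeting every right coset, no
two of whose elements lie in the same right coset. -/
theorem isPerfectCode_iff {G : Type*} [Group G] (H : Subgroup G) :
    H.IsPerfectCode ↔ ∃ T : Set G, (∀ t ∈ T, t⁻¹ ∈ T) ∧ (∀ g, ∃ t ∈ T, g * t⁻¹ ∈ H) ∧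
      ∀ s ∈ T, ∀ t ∈ T, s * t⁻¹ ∈ H → s = t := by
  unfold IsPerfectCode
  simp_rw [isComplement_iff_existsUnique_mul_inv_mem]
  refine exists_congr fun T => and_congr ⟨fun h t ht => ?_, fun h => ?_⟩ ⟨fun h => ⟨fun g => ?_,
    fun s hs t ht hst => ?_⟩, fun h g => ?_⟩
  · rw [← h]
    simpa using ht
  · ext t
    exact ⟨fun ht => by simpa using h _ ht, fun ht => h t ht⟩
  · obtain ⟨t, ht, -⟩ := h g
    exact ⟨t, t.2, ht⟩
  · have := (h s).unique (y₁ := ⟨s, hs⟩) (y₂ := ⟨t, ht⟩) (by simp) hst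
    exact congrArg Subtype.val this
  · obtain ⟨t, ht, hgt⟩ := h.1 g
    refine ⟨⟨t, ht⟩, hgt, fun s hs => Subtype.ext (h.2 _ s.2 _ ht ?_)⟩
    have := H.mul_mem (H.inv_mem hs) hgt
    simpa [mul_assoc] using this

theorem IsPerfectCode.map_mulEquiv_s19 {G G' : Type*} [Group G] [Group G'] {H : Subgroup G}
    (h : H.IsPerfectCode) (e : G ≃* G') : (H.map e.toMonoidHom).IsPerfectCode := by
  rw [isPerfectCode_iff] at h ⊢
  obtain ⟨T, hinv, hcover, huniq⟩ := h
  refine ⟨e.symm ⁻¹' T, fun t ht => by simpa using hinv _ ht, fun g => ?_, fun s hs t ht hst => ?_⟩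
  · obtain ⟨t, ht, hgt⟩ := hcover (e.symm g)
    exact ⟨e t, by simpa using ht, _, hgt, by simp⟩
  · obtain ⟨h, hh, hst⟩ := hst
    refine e.symm.injective (huniq _ hs _ ht ?_)
    have : h = e.symm s * (e.symm t)⁻¹ := by
      apply e.injective
      simpa using hst
    exact this ▸ hh

theorem isPerfectCode_map_mulEquiv_iff {G G' : Type*} [Group G] [Group G'] {H : Subgroup G}
    (e : G ≃* G') : (H.map e.toMonoidHom).IsPerfectCode ↔ H.IsPerfectCode := by
  refine ⟨fun h => ?_, fun h => h.map_mulEquiv_s19 e⟩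
  have := h.map_mulEquiv_s19 e.symm
  rw [map_map] at this
  convert this
  ext x
  simp

theorem isPerfectCode_bot {G : Type*} [Group G] : (⊥ : Subgroup G).IsPerfectCode :=
  (isPerfectCode_iff _).2 ⟨Set.univ, by simp, fun g => ⟨g, by simp⟩, by simp [mul_inv_eq_one]⟩

theorem isPerfectCode_top {G : Type*} [Group G] : (⊤ : Subgroup G).IsPerfectCode :=
  (isPerfectCode_iff _).2 ⟨{1}, by simp, by simp, by simp⟩

theorem IsPerfectCode.prod {P K : Type*} [Group P] [Group K] {Q : Subgroup P} {L : Subgroup K}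
    (hQ : Q.IsPerfectCode) (hL : L.IsPerfectCode) : (Q.prod L).IsPerfectCode := by
  rw [isPerfectCode_iff] at *
  obtain ⟨S, hS, hS', hS''⟩ := hQ
  obtain ⟨T, hT, hT', hT''⟩ := hL
  refine ⟨S ×ˢ T, fun t ht => ⟨hS _ ht.1, hT _ ht.2⟩, fun g => ?_, fun s hs t ht hst => ?_⟩
  · obtain ⟨s, hs, hgs⟩ := hS' g.1
    obtain ⟨t, ht, hgt⟩ := hT' g.2
    exact ⟨(s, t), ⟨hs, ht⟩, hgs, hgt⟩
  · exact Prod.ext (hS'' _ hs.1 _ ht.1 hst.1) (hT'' _ hs.2 _ ht.2 hst.2)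

theorem IsPerfectCode.of_prod {P K : Type*} [Group P] [Group K] {Q : Subgroup P} {L : Subgroup K}
    (h : (Q.prod L).IsPerfectCode) : Q.IsPerfectCode := by
  rw [isPerfectCode_iff] at *
  obtain ⟨T, hT, hT', hT''⟩ := h
  refine ⟨{p | ∃ l ∈ L, (p, l) ∈ T}, fun t ⟨l, hl, ht⟩ => ⟨l⁻¹, L.inv_mem hl, hT _ ht⟩,
    fun g => ?_, ?_⟩
  · obtain ⟨t, ht, hgt⟩ := hT' (g, 1)
    exact ⟨t.1, ⟨t.2, by simpa using hgt.2, ht⟩, hgt.1⟩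
  · rintro s ⟨l, hl, hs⟩ t ⟨m, hm, ht⟩ hst
    exact congrArg Prod.fst (hT'' _ hs _ ht ⟨hst, L.mul_mem hl (L.inv_mem hm)⟩)

end Subgroup

theorem eq_one_of_inv_eq_self_of_odd_card {G : Type*} [Group G] (hG : Odd (Nat.card G)) {x : G}
    (hx : x⁻¹ = x) : x = 1 := by
  have h2 : orderOf x ∣ 2 := orderOf_dvd_of_pow_eq_one (by
    rw [pow_two]
    nth_rewrite 1 [← hx]
    simp)
  have := Nat.Coprime.eq_one_of_dvd
    (hG.coprime_two_right.coprime_dvd_left (orderOf_dvd_natCard x)) h2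
  exact orderOf_eq_one_iff.1 this

/-- A surjection onto a group without involutions has an inverse-preserving section. -/
theorem MonoidHom.exists_section_map_inv {G G' : Type*} [Group G] [Group G'] (f : G →* G')
    (hf : Function.Surjective f) (hodd : Odd (Nat.card G')) :
    ∃ g : G' → G, (∀ x, f (g x) = x) ∧ ∀ x, g x⁻¹ = (g x)⁻¹ := by
  classical
  obtain ⟨s, hs⟩ := hf.hasRightInverse
  let _ : LinearOrder G' := WellOrderingRel.isWellOrder.linearOrder
  refine ⟨fun x => if x < x⁻¹ then s x else if x⁻¹ < x then (s x⁻¹)⁻¹ else 1, fun x => ?_,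
    fun x => ?_⟩
  · rcases lt_trichotomy x x⁻¹ with h | h | h
    · simp [h, hs x]
    · rw [eq_one_of_inv_eq_self_of_odd_card hodd h.symm]
      simp
    · simp [h, h.not_gt, hs x⁻¹]
  · rcases lt_trichotomy x x⁻¹ with h | h | h
    · simp [h, h.not_gt]
    · rw [eq_one_of_inv_eq_self_of_odd_card hodd h.symm]
      simp
    · simp [h, h.not_gt]

/-- Every subgroup of a nilpotent group of odd order is a perfect code. -/
theorem Subgroup.isPerfectCode_of_odd_card {G : Type*} [Group G] [Group.IsNilpotent G]
    (hG : Odd (Nat.card G)) (L : Subgroup G) : L.IsPerfectCode := by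
  revert L hG
  refine Group.nilpotent_center_quotient_ind (P := fun G _ _ => Odd (Nat.card G) →
    ∀ L : Subgroup G, L.IsPerfectCode) G ?_ ?_
  · intro G _ _ _ L
    rw [Subsingleton.elim L ⊤]
    exact isPerfectCode_top
  · intro G _ _ ih hG L
    have hquot : Odd (Nat.card (G ⧸ center G)) := hG.of_dvd_nat (card_quotient_dvd_card _)
    have hcent : Odd (Nat.card (center G)) := hG.of_dvd_nat (card_subgroup_dvd_card _)
    obtain ⟨T, hT, hcover, huniq⟩ :=
      (isPerfectCode_iff _).1 (ih hquot (L.map (QuotientGroup.mk' (center G))))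
    obtain ⟨g, hg, hginv⟩ := (QuotientGroup.mk' (center G)).exists_section_map_inv
      (QuotientGroup.mk'_surjective _) hquot
    obtain ⟨s, hs, hsinv⟩ := (QuotientGroup.mk' (L.subgroupOf (center G))).exists_section_map_inv
      (QuotientGroup.mk'_surjective _) (hcent.of_dvd_nat (card_quotient_dvd_card _))
    have hcomm (z : center G) (x : G) : x * z = z * x := mem_center_iff.1 z.2 x
    refine (isPerfectCode_iff _).2 ⟨{x | ∃ c, ∃ t ∈ T, x = s c * g t}, ?_, fun x => ?_, ?_⟩
    · rintro _ ⟨c, t, ht, rfl⟩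
      refine ⟨c⁻¹, t⁻¹, hT t ht, ?_⟩
      rw [hginv, hsinv, mul_inv_rev, coe_inv, ← coe_inv, hcomm]
    · obtain ⟨t, ht, l, hl, hxt⟩ := hcover (x : G ⧸ center G)
      have hz : l⁻¹ * (x * (g t)⁻¹) ∈ center G := by
        rw [← QuotientGroup.eq]
        have hgt : ((g t : G) : G ⧸ center G) = t := hg t
        simpa [hgt] using hxt
      set z : center G := ⟨_, hz⟩ with hzdef
      have hn : z * (s (z : center G ⧸ L.subgroupOf (center G)))⁻¹ ∈ L.subgroupOf (center G) := by
        have h := mem_subgroupOf.1 (QuotientGroup.eq.1 (hs z))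
        rw [mem_subgroupOf]
        rwa [coe_mul, hcomm] at h
      refine ⟨_, ⟨(z : center G ⧸ L.subgroupOf (center G)), t, ht, rfl⟩, ?_⟩
      convert L.mul_mem hl (mem_subgroupOf.1 hn) using 1
      simp [hzdef, mul_assoc]
    · rintro _ ⟨c, t, ht, rfl⟩ _ ⟨d, u, hu, rfl⟩ hmem
      have hsz (c) : ((s c : G) : G ⧸ center G) = 1 := (QuotientGroup.eq_one_iff _).2 (s c).2
      have hgt (t) : ((g t : G) : G ⧸ center G) = t := hg t
      obtain rfl : t = u := huniq t ht u hu ⟨_, hmem, by simp [hsz, hgt]⟩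
      have hcd : c = d := by
        rw [← hs c, ← hs d]
        refine QuotientGroup.eq.2 ?_
        rw [mem_subgroupOf]
        convert L.inv_mem hmem using 1
        simp only [mul_inv_rev, inv_inv, coe_mul, coe_inv, mul_assoc, mul_inv_cancel_left]
        rw [← coe_inv, hcomm]
      rw [hcd]

universe u in
/-- A finite nilpotent group is the direct product of a `2`-group and a nilpotent group of odd
order. -/
theorem Group.IsNilpotent.exists_mulEquiv_prod_odd {G : Type u} [Group G] [Finite G]
    [Group.IsNilpotent G] : ∃ (P K : Type u) (_ : Group P) (_ : Group K), Finite P ∧ Finite K ∧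
      IsPGroup 2 P ∧ Group.IsNilpotent K ∧ Odd (Nat.card K) ∧ Nonempty (G ≃* P × K) := by
  classical
  obtain ⟨φ⟩ := ((Group.isNilpotent_of_finite_tfae (G := G)).out 0 4 rfl rfl).1 ‹_›
  let A (p : (Nat.card G).primeFactors) := ∀ P : Sylow p G, (P : Subgroup G)
  let ψ : (∀ p, A p) ≃* (∀ p : {p : (Nat.card G).primeFactors // p.1 = 2}, A p.1) ×
      (∀ p : {p : (Nat.card G).primeFactors // ¬ p.1 = 2}, A p.1) :=
    { Equiv.piEquivPiSubtypeProd (fun p : (Nat.card G).primeFactors => p.1 = 2) A with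
      map_mul' := fun _ _ => rfl }
  refine ⟨_, _, inferInstance, inferInstance, inferInstance, inferInstance, ?_, ?_, ?_,
    ⟨φ.symm.trans ψ⟩⟩
  · rw [IsPGroup.iff_card, Nat.card_pi]
    refine Finset.prod_induction _ (fun k => ∃ n, k = 2 ^ n) ?_ ⟨0, rfl⟩ ?_
    · rintro _ _ ⟨m, rfl⟩ ⟨n, rfl⟩
      exact ⟨m + n, (pow_add _ _ _).symm⟩
    · rintro ⟨⟨p, hp⟩, hp2⟩ -
      have : Fact p.Prime := ⟨Nat.prime_of_mem_primeFactors hp⟩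
      let _ := Fintype.ofFinite (Sylow p G)
      rw [Nat.card_pi]
      refine Finset.prod_induction _ (fun k => ∃ n, k = 2 ^ n) ?_ ⟨0, rfl⟩ fun P _ => ?_
      · rintro _ _ ⟨m, rfl⟩ ⟨n, rfl⟩
        exact ⟨m + n, (pow_add _ _ _).symm⟩
      · obtain ⟨n, hn⟩ := IsPGroup.iff_card.1 P.isPGroup'
        exact ⟨n, hn.trans (congrArg (· ^ n) hp2)⟩
  · exact Group.nilpotent_of_surjective ((MonoidHom.snd _ _).comp (φ.symm.trans ψ).toMonoidHom)
      (Prod.snd_surjective.comp (φ.symm.trans ψ).surjective)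
  · rw [Nat.card_pi]
    refine Finset.prod_induction _ Odd (fun _ _ => Odd.mul) odd_one ?_
    rintro ⟨⟨p, hp⟩, hp2⟩ -
    have hprime := Nat.prime_of_mem_primeFactors hp
    have : Fact p.Prime := ⟨hprime⟩
    let _ := Fintype.ofFinite (Sylow p G)
    rw [Nat.card_pi]
    refine Finset.prod_induction _ Odd (fun _ _ => Odd.mul) odd_one fun P _ => ?_
    obtain ⟨n, hn⟩ := IsPGroup.iff_card.1 P.isPGroup'
    exact hn ▸ (hprime.odd_of_ne_two hp2).pow

/-- A subgroup of a product of groups of coprime orders contains the first components of its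
elements. -/
theorem Subgroup.fst_mem_of_coprime_card {P K : Type*} [Group P] [Group K]
    (hPK : (Nat.card P).Coprime (Nat.card K)) {X : Subgroup (P × K)} {x : P × K} (hx : x ∈ X) :
    (x.1, 1) ∈ X := by
  obtain ⟨n, hnP, hnK⟩ := Nat.chineseRemainder hPK 1 0
  convert X.pow_mem hx n using 1
  refine Prod.ext ?_ ?_
  · have := pow_eq_pow_iff_modEq.2 (hnP.of_dvd (_root_.orderOf_dvd_natCard x.1))
    simpa using this.symm
  · have := pow_eq_pow_iff_modEq.2 (hnK.of_dvd (_root_.orderOf_dvd_natCard x.2))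
    simpa using this.symm

theorem Subgroup.eq_prod_map_of_coprime_card {P K : Type*} [Group P] [Group K]
    (hPK : (Nat.card P).Coprime (Nat.card K)) (X : Subgroup (P × K)) :
    X = (X.map (MonoidHom.fst P K)).prod (X.map (MonoidHom.snd P K)) := by
  refine le_antisymm (fun x hx => ⟨⟨x, hx, rfl⟩, x, hx, rfl⟩) ?_
  rintro ⟨a, b⟩ ⟨⟨x, hx, rfl⟩, y, hy, rfl⟩
  have := X.mul_mem (fst_mem_of_coprime_card hPK hx)
    (X.mul_mem (X.inv_mem (fst_mem_of_coprime_card hPK hy)) hy)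
  simpa [Prod.mul_def] using this

/-- In a group whose Sylow `p`-subgroup is normal, it consists of all `p`-elements. -/
theorem Sylow.mem_iff_exists_pow_eq_one {G : Type*} [Group G] {p : ℕ} [Fact p.Prime]
    (Q : Sylow p G) [Finite (Sylow p G)] [(Q : Subgroup G).Normal] {x : G} :
    x ∈ Q ↔ ∃ n : ℕ, x ^ p ^ n = 1 := by
  refine ⟨fun hx => ?_, fun ⟨n, hn⟩ => ?_⟩
  · obtain ⟨n, hn⟩ := Q.isPGroup' ⟨x, hx⟩
    exact ⟨n, congrArg Subtype.val hn⟩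
  · have hz : IsPGroup p (Subgroup.zpowers x) := by
      rintro ⟨_, k, rfl⟩
      refine ⟨n, Subtype.ext ?_⟩
      change (x ^ k) ^ p ^ n = 1
      rw [← zpow_natCast, ← zpow_mul, mul_comm, zpow_mul, zpow_natCast, hn, one_zpow]
    obtain ⟨R, hR⟩ := hz.exists_le_sylow
    have := Sylow.unique_of_normal Q inferInstance
    rw [Subsingleton.elim Q R]
    exact hR (Subgroup.mem_zpowers x)

theorem nilpotent_isPerfectCode_iff_sylow_two {G : Type*} [Group G] [Finite G]
    (hn : Group.IsNilpotent G) (H : Subgroup G) (Q : Sylow 2 H) :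
    H.IsPerfectCode ↔ ((Q : Subgroup H).map H.subtype).IsPerfectCode := by
  obtain ⟨P, K, _, _, _, _, hP, _, hK, ⟨e⟩⟩ :=
    Group.IsNilpotent.exists_mulEquiv_prod_odd (G := G)
  have hPK : (Nat.card P).Coprime (Nat.card K) := by
    obtain ⟨n, hn⟩ := IsPGroup.iff_card.1 hP
    exact hn ▸ hK.coprime_two_left.pow_left n
  have hQ : ((Q : Subgroup H).map H.subtype).map e.toMonoidHom =
      ((H.map e.toMonoidHom).map (MonoidHom.fst P K)).prod ⊥ := by
    ext ⟨a, b⟩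
    constructor
    · rintro ⟨_, ⟨x, hx, rfl⟩, hxab⟩
      obtain ⟨n, hn⟩ := Q.mem_iff_exists_pow_eq_one.1 hx
      have hpow : e x ^ 2 ^ n = 1 := by
        rw [← map_pow, ← Subgroup.coe_pow, hn]
        simp
      have hxab : e x = (a, b) := hxab
      rw [hxab] at hpow
      have hb : orderOf b = 1 := Nat.Coprime.eq_one_of_dvd
        ((hK.coprime_two_right.pow_right n).coprime_dvd_left (orderOf_dvd_natCard b))
        (orderOf_dvd_of_pow_eq_one (congrArg Prod.snd hpow))
      exact ⟨⟨_, ⟨x, x.2, hxab⟩, rfl⟩, orderOf_eq_one_iff.1 hb⟩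
    · rintro ⟨⟨y, hy, rfl⟩, rfl : b = 1⟩
      obtain ⟨x, hx, hxy⟩ := Subgroup.fst_mem_of_coprime_card hPK hy
      refine ⟨x, ⟨⟨x, hx⟩, Q.mem_iff_exists_pow_eq_one.2 ?_, rfl⟩, hxy⟩
      obtain ⟨n, hn⟩ := hP y.1
      refine ⟨n, Subtype.ext (e.injective ?_)⟩
      have hxy : e x = (y.1, 1) := hxy
      simp [hxy, hn]
  rw [← Subgroup.isPerfectCode_map_mulEquiv_iff e,
    ← Subgroup.isPerfectCode_map_mulEquiv_iff (H := (Q : Subgroup H).map H.subtype) e, hQ]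
  have hX := Subgroup.eq_prod_map_of_coprime_card hPK (H.map e.toMonoidHom)
  refine ⟨fun h => ?_, fun h => ?_⟩
  · rw [hX] at h
    exact h.of_prod.prod Subgroup.isPerfectCode_bot
  · rw [hX]
    exact h.of_prod.prod (Subgroup.isPerfectCode_of_odd_card hK _)
end
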